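/- arXiv:1707.05906 — 6 statements merged into one kernel-verified Lean document; each statement's English description precedes it below -/
import Mathlib

section
/- Let 𝒜 be a set of half-axes of A that generates A as an 𝔽-algebra. Suppose that for every e ∈ 𝒜, every u ∈ A_{1/2}(e) and every z ∈ A_0(e) one has (a) u³ = δ_{u²}·u (δ taken with respect to e) and (b) (uz)z = (1/2)·uz². Then A is a Jordan algebra, i.e., (xy)x² = x(yx²) for all x, y ∈ A. -/
/-- `A_λ(e)`-based definition of a half-axis in a commutative non-associative `F`-algebra `A`:
`e` is idempotent, `A_1(e) = F e`, `A = F e ⊕ A_{1/2}(e) ⊕ A_0(e)`, and the fusion rules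
`Z Z ⊆ Z`, `U U ⊆ F e + Z`, `U Z ⊆ U` hold, where `U = A_{1/2}(e)` and `Z = A_0(e)`. -/
structure IsHalfAxis (F : Type*) [Field F] {A : Type*} [NonUnitalNonAssocCommRing A]
    [Module F A] [SMulCommClass F A A] [IsScalarTower F A A] (e : A) : Prop where
  idem : e * e = e
  eig_one : {y : A | e * y = y} = {y : A | ∃ c : F, y = c • e}
  decomp : ∀ x : A, ∃ (c : F) (u z : A),
      e * u = (2⁻¹ : F) • u ∧ e * z = 0 ∧ x = c • e + u + z
  indep : ∀ (c : F) (u z : A), e * u = (2⁻¹ : F) • u → e * z = 0 →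
      c • e + u + z = 0 → c = 0 ∧ u = 0 ∧ z = 0
  fusionZZ : ∀ z z' : A, e * z = 0 → e * z' = 0 → e * (z * z') = 0
  fusionUU : ∀ u u' : A, e * u = (2⁻¹ : F) • u → e * u' = (2⁻¹ : F) • u' →
      ∃ (c : F) (z : A), e * z = 0 ∧ u * u' = c • e + z
  fusionUZ : ∀ u z : A, e * u = (2⁻¹ : F) • u → e * z = 0 →
      e * (u * z) = (2⁻¹ : F) • (u * z)

/-- The part of the half-axis axioms, together with the two identities `u³ = δ u` and
`(u z) z = ½ u z²`, that is used to derive the Jordan identity. -/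
structure IsJordanAxis (F : Type*) [Field F] {A : Type*} [NonUnitalNonAssocCommRing A]
    [Module F A] (e : A) : Prop where
  idem : e * e = e
  decomp : ∀ x : A, ∃ (c : F) (u z : A),
      e * u = (2⁻¹ : F) • u ∧ e * z = 0 ∧ x = c • e + u + z
  fusionZZ : ∀ z z' : A, e * z = 0 → e * z' = 0 → e * (z * z') = 0
  fusionUU : ∀ u u' : A, e * u = (2⁻¹ : F) • u → e * u' = (2⁻¹ : F) • u' →
      ∃ (c : F) (z : A), e * z = 0 ∧ u * u' = c • e + z
  fusionUZ : ∀ u z : A, e * u = (2⁻¹ : F) • u → e * z = 0 →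
      e * (u * z) = (2⁻¹ : F) • (u * z)
  cube : ∀ u : A, e * u = (2⁻¹ : F) • u →
      ∀ (δ : F) (z' : A), e * z' = 0 → u * u = δ • e + z' → (u * u) * u = δ • u
  mul_mul_half : ∀ u z : A, e * u = (2⁻¹ : F) • u → e * z = 0 →
      (u * z) * z = (2⁻¹ : F) • (u * (z * z))

/-- An involutive automorphism maps Jordan axes to Jordan axes. -/
theorem IsJordanAxis.map {F : Type*} [Field F] {A : Type*} [NonUnitalNonAssocCommRing A]
    [Module F A] {e : A} (he : IsJordanAxis F e) (σ : A →ₗ[F] A)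
    (hmul : ∀ x y, σ (x * y) = σ x * σ y) (hinv : ∀ x, σ (σ x) = x) :
    IsJordanAxis F (σ e) := by
  have hU : ∀ {u : A}, σ e * u = (2⁻¹ : F) • u → e * σ u = (2⁻¹ : F) • σ u := fun {u} h => by
    rw [← map_smul, ← h, hmul, hinv]
  have hZ : ∀ {z : A}, σ e * z = 0 → e * σ z = 0 := fun {z} h => by
    rw [← map_zero σ, ← h, hmul, hinv]
  have hinj : Function.Injective σ := Function.LeftInverse.injective hinv
  refine ⟨?_, ?_, ?_, ?_, ?_, ?_, ?_⟩
  · rw [← hmul, he.idem]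
  · intro x
    obtain ⟨c, u, z, hu, hz, hx⟩ := he.decomp (σ x)
    refine ⟨c, σ u, σ z, ?_, ?_, ?_⟩
    · rw [← hmul, hu, map_smul]
    · rw [← hmul, hz, map_zero]
    · rw [← hinv x, hx, map_add, map_add, map_smul]
  · intro z z' hz hz'
    apply hinj
    rw [hmul, hinv, hmul, map_zero, he.fusionZZ _ _ (hZ hz) (hZ hz')]
  · intro u u' hu hu'
    obtain ⟨c, z, hz, h⟩ := he.fusionUU _ _ (hU hu) (hU hu')
    refine ⟨c, σ z, ?_, ?_⟩
    · rw [← hmul, hz, map_zero]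
    · rw [← hinv (u * u'), hmul, h, map_add, map_smul]
  · intro u z hu hz
    apply hinj
    rw [hmul, hinv, map_smul, hmul, he.fusionUZ _ _ (hU hu) (hZ hz)]
  · intro u hu δ z' hz' h
    apply hinj
    rw [hmul, hmul, map_smul]
    refine he.cube _ (hU hu) δ (σ z') (hZ hz') ?_
    rw [← hmul, h, map_add, map_smul, hinv]
  · intro u z hu hz
    apply hinj
    rw [hmul, hmul, map_smul, hmul, hmul]
    exact he.mul_mul_half _ _ (hU hu) (hZ hz)

section JordanAxis

variable {F : Type*} [Field F] {A : Type*} [NonUnitalNonAssocCommRing A]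
  [Module F A] [SMulCommClass F A A] [IsScalarTower F A A]

/-- The Jordan identity `(x y) x² = x (y x²)` holds when `y` is a Jordan axis. -/
theorem IsJordanAxis.jordan_identity (h2 : (2 : F) ≠ 0) {e : A} (he : IsJordanAxis F e) (x : A) :
    (x * e) * (x * x) = x * (e * (x * x)) := by
  obtain ⟨c, u, z, hu, hz, rfl⟩ := he.decomp x
  obtain ⟨d, w, hw, huu⟩ := he.fusionUU u u hu hu
  have hzz := he.fusionZZ z z hz hz
  have huz := he.fusionUZ u z hu hz
  have hcube := he.cube u hu d w hw huu
  have hmul := he.mul_mul_half u z hu hz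
  have hee := he.idem
  have huw : u * w = d • u - (d * 2⁻¹) • u := by
    rw [huu, add_mul, smul_mul_assoc, hu] at hcube
    rw [← hcube, mul_comm u w, mul_smul]
    abel
  have hxe : (c • e + u + z) * e = c • e + (2⁻¹ : F) • u := by
    rw [mul_comm, mul_add, mul_add, mul_smul_comm, hee, hu, hz, add_zero]
  have hxx : (c • e + u + z) * (c • e + u + z) =
      (c ^ 2 + d) • e + (c • u + (2 : F) • (u * z)) + (w + z * z) := by
    simp only [mul_add, add_mul, smul_mul_assoc, mul_smul_comm, hee, hu, hz, huu,
      mul_comm u e, mul_comm z e, mul_comm z u]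
    match_scalars <;> field_simp <;> ring
  have hexx : e * ((c ^ 2 + d) • e + (c • u + (2 : F) • (u * z)) + (w + z * z)) =
      (c ^ 2 + d) • e + (c * 2⁻¹) • u + u * z := by
    simp only [mul_add, mul_smul_comm, hee, hu, hw, hzz, huz]
    match_scalars <;> field_simp
  rw [hxe, hxx, hexx]
  simp only [mul_add, add_mul, smul_mul_assoc, mul_smul_comm, hee, hu, hz, hw, huu, hzz, huz,
    huw, mul_comm u e, mul_comm z e, mul_comm z u, mul_comm z (u * z), hmul]
  match_scalars <;> field_simp <;> ring

/-- The Miyamoto involution of `e`, negating the `½`-eigenspace of `e`. -/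
def miyamoto (F : Type*) [Field F] {A : Type*} [NonUnitalNonAssocCommRing A]
    [Module F A] [SMulCommClass F A A] [IsScalarTower F A A] (e : A) : A →ₗ[F] A :=
  LinearMap.id - (8 : F) • LinearMap.mulLeft F e +
    (8 : F) • (LinearMap.mulLeft F e ∘ₗ LinearMap.mulLeft F e)

theorem miyamoto_apply (e x : A) :
    miyamoto F e x = x - (8 : F) • (e * x) + (8 : F) • (e * (e * x)) := by
  simp [miyamoto]

theorem miyamoto_decomp (h2 : (2 : F) ≠ 0) {e : A} (hee : e * e = e) {u z : A} (c : F)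
    (hu : e * u = (2⁻¹ : F) • u) (hz : e * z = 0) :
    miyamoto F e (c • e + u + z) = c • e - u + z := by
  rw [miyamoto_apply]
  simp only [mul_add, mul_smul_comm, hee, hu, hz, mul_zero]
  match_scalars <;> field_simp <;> ring

theorem miyamoto_miyamoto (h2 : (2 : F) ≠ 0) {e : A} (he : IsJordanAxis F e) (x : A) :
    miyamoto F e (miyamoto F e x) = x := by
  obtain ⟨c, u, z, hu, hz, rfl⟩ := he.decomp x
  have hu' : e * -u = (2⁻¹ : F) • -u := by rw [mul_neg, hu, smul_neg]
  rw [miyamoto_decomp h2 he.idem c hu hz, sub_eq_add_neg,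
    miyamoto_decomp h2 he.idem c hu' hz, sub_neg_eq_add]

theorem miyamoto_mul (h2 : (2 : F) ≠ 0) {e : A} (he : IsJordanAxis F e) (x y : A) :
    miyamoto F e (x * y) = miyamoto F e x * miyamoto F e y := by
  obtain ⟨c, u, z, hu, hz, rfl⟩ := he.decomp x
  obtain ⟨c', u', z', hu', hz', rfl⟩ := he.decomp y
  obtain ⟨d, w, hw, huu⟩ := he.fusionUU u u' hu hu'
  have hzz := he.fusionZZ z z' hz hz'
  have huz := he.fusionUZ u z' hu hz'
  have huz' := he.fusionUZ u' z hu' hz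
  have hee := he.idem
  have hxy : (c • e + u + z) * (c' • e + u' + z') = (c * c' + d) • e +
      ((c * 2⁻¹) • u' + (c' * 2⁻¹) • u + u * z' + u' * z) + (w + z * z') := by
    simp only [mul_add, add_mul, smul_mul_assoc, mul_smul_comm, hee, hu, hz, hu', hz', huu,
      mul_comm u e, mul_comm z e, mul_comm z u']
    module
  have hU : e * ((c * 2⁻¹) • u' + (c' * 2⁻¹) • u + u * z' + u' * z) =
      (2⁻¹ : F) • ((c * 2⁻¹) • u' + (c' * 2⁻¹) • u + u * z' + u' * z) := by
    simp only [mul_add, mul_smul_comm, hu, hu', huz, huz']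
    module
  have hZ : e * (w + z * z') = 0 := by rw [mul_add, hw, hzz, add_zero]
  rw [hxy, miyamoto_decomp h2 hee _ hU hZ, miyamoto_decomp h2 hee _ hu hz,
    miyamoto_decomp h2 hee _ hu' hz']
  simp only [mul_add, add_mul, mul_sub, sub_mul, smul_mul_assoc, mul_smul_comm, hee, hu, hz,
    hu', hz', huu, mul_comm u e, mul_comm z e, mul_comm z u']
  module

/-- The linear span of the Jordan axes is closed under multiplication. -/
theorem mul_mem_span_isJordanAxis (h2 : (2 : F) ≠ 0) {x y : A}
    (hx : x ∈ Submodule.span F {e : A | IsJordanAxis F e})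
    (hy : y ∈ Submodule.span F {e : A | IsJordanAxis F e}) :
    x * y ∈ Submodule.span F {e : A | IsJordanAxis F e} := by
  induction hx, hy using Submodule.span_induction₂ with
  | mem_mem e b he hb =>
    have hτ : IsJordanAxis F (miyamoto F e b) :=
      IsJordanAxis.map hb _ (miyamoto_mul h2 he) (miyamoto_miyamoto h2 he)
    obtain ⟨c, u, z, hu, hz, hx⟩ := IsJordanAxis.decomp he b
    have heb : e * b = c • e + (4⁻¹ : F) • (b - miyamoto F e b) := by
      have h4 : (4 : F) = 2 * 2 := by norm_num
      rw [hx, miyamoto_decomp h2 (IsJordanAxis.idem he) c hu hz, mul_add, mul_add,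
        mul_smul_comm, IsJordanAxis.idem he, hu, hz, h4]
      match_scalars <;> field_simp <;> ring
    rw [heb]
    exact add_mem (Submodule.smul_mem _ _ (Submodule.subset_span he))
      (Submodule.smul_mem _ _ (sub_mem (Submodule.subset_span hb) (Submodule.subset_span hτ)))
  | zero_left y hy => rw [zero_mul]; exact zero_mem _
  | zero_right x hx => rw [mul_zero]; exact zero_mem _
  | add_left x y z hx hy hz h1 h2 => rw [add_mul]; exact add_mem h1 h2
  | add_right x y z hx hy hz h1 h2 => rw [mul_add]; exact add_mem h1 h2
  | smul_left r x y hx hy h => rw [smul_mul_assoc]; exact Submodule.smul_mem _ _ h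
  | smul_right r x y hx hy h => rw [mul_smul_comm]; exact Submodule.smul_mem _ _ h

end JordanAxis

theorem stmt0 {F : Type*} [Field F] {A : Type*} [NonUnitalNonAssocCommRing A]
    [Module F A] [SMulCommClass F A A] [IsScalarTower F A A]
    (h2 : (2 : F) ≠ 0)
    (𝒜 : Set A) (hgen : NonUnitalAlgebra.adjoin F 𝒜 = ⊤)
    (hax : ∀ e ∈ 𝒜, IsHalfAxis F e)
    (ha : ∀ e ∈ 𝒜, ∀ u : A, e * u = (2⁻¹ : F) • u →
      ∀ (δ : F) (z' : A), e * z' = 0 → u * u = δ • e + z' → (u * u) * u = δ • u)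
    (hb : ∀ e ∈ 𝒜, ∀ u z : A, e * u = (2⁻¹ : F) • u → e * z = 0 →
      (u * z) * z = (2⁻¹ : F) • (u * (z * z))) :
    ∀ x y : A, (x * y) * (x * x) = x * (y * (x * x)) := by
  intro x y
  have hy : y ∈ Submodule.span F {e : A | IsJordanAxis F e} := by
    have hy' : y ∈ NonUnitalAlgebra.adjoin F 𝒜 := hgen ▸ NonUnitalAlgebra.mem_top
    induction hy' using NonUnitalAlgebra.adjoin_induction with
    | mem e he =>
      have h := hax e he
      exact Submodule.subset_span ⟨h.idem, h.decomp, h.fusionZZ, h.fusionUU, h.fusionUZ,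
        ha e he, hb e he⟩
    | add x y hx hy h1 h2 => exact add_mem h1 h2
    | zero => exact zero_mem _
    | mul x y hx hy h1 h3 => exact mul_mem_span_isJordanAxis h2 h1 h3
    | smul r x hx h => exact Submodule.smul_mem _ _ h
  induction hy using Submodule.span_induction with
  | mem e he => exact IsJordanAxis.jordan_identity h2 he x
  | zero => simp
  | add a b ha hb h1 h2 => simp only [mul_add, add_mul, h1, h2]
  | smul r a ha h => simp only [mul_smul_comm, smul_mul_assoc, h]
end

section
/- Suppose 𝔽 has more than 3 elements and A is a primitive axial algebra of Jordan type half (generated as an 𝔽-algebra by a set of half-axes). Then A is a Jordan algebra if and only if the identities x²x² = x³x and x³x² = x·x⁴ hold for all x ∈ A. -/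
section Linearization

variable {F : Type*} [Field F] {A : Type*} [NonUnitalNonAssocCommRing A]
  [Module F A] [SMulCommClass F A A]

theorem exists_ne_zero_sq_ne_one (hF : 3 < Cardinal.mk F) : ∃ t : F, t ≠ 0 ∧ t ^ 2 ≠ 1 := by
  classical
  by_contra! h
  have hsub : (Set.univ : Set F) ⊆ (({0, 1, -1} : Finset F) : Set F) := by
    intro t _
    by_cases ht : t = 0
    · simp [ht]
    · rcases eq_or_eq_neg_of_sq_eq_sq t 1 <| by simpa using (h t ht) with h | h <;> simp [h]
  have h1 : Cardinal.mk F ≤ 3 := by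
    rw [← Cardinal.mk_univ]
    refine (Cardinal.mk_le_mk_of_subset hsub).trans ?_
    have h3 : (({0, 1, -1} : Finset F)).card ≤ 3 := Finset.card_le_three
    exact (Cardinal.mk_coe_finset (s := ({0, 1, -1} : Finset F))).le.trans (by exact_mod_cast h3)
  exact absurd hF (not_lt.2 h1)

theorem linearize_four (h2 : (2 : F) ≠ 0) (hF : 3 < Cardinal.mk F)
    (h4 : ∀ x : A, (x * x) * (x * x) = ((x * x) * x) * x) (x y : A) :
    (4 : F) • ((x * x) * (x * y)) =
      ((x * x) * x) * y + x * ((x * x) * y) + (2 : F) • (x * (x * (x * y))) := by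
  obtain ⟨t, ht0, ht1⟩ := exists_ne_zero_sq_ne_one hF
  let P : A → A := fun x => (x * x) * (x * x) - ((x * x) * x) * x
  have hP : ∀ x, P x = 0 := fun x => sub_eq_zero.2 (h4 x)
  have key : P (x + t • y) - P (x + (-t) • y) - t ^ 3 • (P (x + y) - P (x + (-1 : F) • y)) =
      (2 * t - 2 * t ^ 3) • ((4 : F) • ((x * x) * (x * y)) -
      (((x * x) * x) * y + x * ((x * x) * y) + (2 : F) • (x * (x * (x * y))))) := by
    simp only [P, mul_add, add_mul, mul_smul_comm, smul_add, smul_smul, mul_comm]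
    module
  simp only [hP, sub_zero, smul_zero] at key
  have hc : 2 * t - 2 * t ^ 3 ≠ 0 := by
    have : 2 * t - 2 * t ^ 3 = 2 * t * (1 - t ^ 2) := by ring
    rw [this]
    exact mul_ne_zero (mul_ne_zero h2 ht0) (sub_ne_zero.2 ht1.symm)
  exact sub_eq_zero.1 ((smul_eq_zero.1 key.symm).resolve_left hc)

theorem linearize_five (h2 : (2 : F) ≠ 0) (hF : 3 < Cardinal.mk F)
    (h5 : ∀ x : A, ((x * x) * x) * (x * x) = x * (((x * x) * x) * x)) (x y : A) :
    ((2 : F) • (x * y * x) + x * x * y) * (x * x) + (2 : F) • ((x * x * x) * (x * y)) =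
      y * (x * x * x * x) + x * (((2 : F) • (x * y * x) + x * x * y) * x + x * x * x * y) := by
  obtain ⟨t, ht0, ht1⟩ := exists_ne_zero_sq_ne_one hF
  let P : A → A := fun x => ((x * x) * x) * (x * x) - x * (((x * x) * x) * x)
  have hP : ∀ x, P x = 0 := fun x => sub_eq_zero.2 (h5 x)
  have key : P (x + t • y) - P (x + (-t) • y) - t ^ 3 • (P (x + y) - P (x + (-1 : F) • y)) -
      (2 * t ^ 5 - 2 * t ^ 3) • P y =
      (2 * t - 2 * t ^ 3) •
      (((2 : F) • (x * y * x) + x * x * y) * (x * x) + (2 : F) • ((x * x * x) * (x * y)) -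
      (y * (x * x * x * x) + x * (((2 : F) • (x * y * x) + x * x * y) * x + x * x * x * y))) := by
    simp only [P, mul_add, add_mul, mul_smul_comm, smul_add, smul_smul, mul_comm]
    module
  simp only [hP, sub_zero, smul_zero] at key
  have hc : 2 * t - 2 * t ^ 3 ≠ 0 := by
    have : 2 * t - 2 * t ^ 3 = 2 * t * (1 - t ^ 2) := by ring
    rw [this]
    exact mul_ne_zero (mul_ne_zero h2 ht0) (sub_ne_zero.2 ht1.symm)
  exact sub_eq_zero.1 ((smul_eq_zero.1 key.symm).resolve_left hc)

end Linearization

section Peirce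

variable {F : Type*} [Field F] {A : Type*} [NonUnitalNonAssocCommRing A]
  [Module F A] [SMulCommClass F A A] [IsScalarTower F A A] {e : A}

namespace IsHalfAxis

theorem half_mul_zero_zero (he : IsHalfAxis F e) (h2 : (2 : F) ≠ 0) (hF : 3 < Cardinal.mk F)
    (h4 : ∀ x : A, (x * x) * (x * x) = ((x * x) * x) * x)
    (h5 : ∀ x : A, ((x * x) * x) * (x * x) = x * (((x * x) * x) * x))
    {u z : A} (hu : e * u = (2⁻¹ : F) • u) (hz : e * z = 0) :
    (z * z) * u = (2 : F) • (z * (z * u)) := by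
  have hUZ : ∀ {w y : A}, e * w = 0 → e * y = (2⁻¹ : F) • y → e * (w * y) = (2⁻¹ : F) • (w * y) :=
    fun {w y} hw hy => by rw [mul_comm w y]; exact he.fusionUZ y w hy hw
  have hz2 : e * (z * z) = 0 := he.fusionZZ _ _ hz hz
  have hz3 : e * (z * z * z) = 0 := he.fusionZZ _ _ hz2 hz
  have hz4 : e * (z * z * z * z) = 0 := he.fusionZZ _ _ hz3 hz
  have H : ∀ s : F,
      ((4 : F) • ((s ^ 2 • e + z * z) * ((s • e + z) * u)) =
        (s ^ 3 • e + z * z * z) * u + (s • e + z) * ((s ^ 2 • e + z * z) * u) +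
        (2 : F) • ((s • e + z) * ((s • e + z) * ((s • e + z) * u)))) ∧
      (s ^ 2 • e + z * z) * ((2 : F) • ((s • e + z) * ((s • e + z) * u)) +
          (s ^ 2 • e + z * z) * u) +
          (2 : F) • ((s ^ 3 • e + z * z * z) * ((s • e + z) * u)) =
        (s ^ 4 • e + z * z * z * z) * u + (s • e + z) * ((s • e + z) *
          ((2 : F) • ((s • e + z) * ((s • e + z) * u)) + (s ^ 2 • e + z * z) * u) +
          (s ^ 3 • e + z * z * z) * u) := by
    intro s
    have e2 : (s • e + z) * (s • e + z) = s ^ 2 • e + z * z := by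
      simp only [add_mul, mul_add, smul_mul_assoc, mul_smul_comm, he.idem, hz, mul_comm z e]
      module
    have e3 : (s ^ 2 • e + z * z) * (s • e + z) = s ^ 3 • e + z * z * z := by
      simp only [add_mul, mul_add, smul_mul_assoc, mul_smul_comm, he.idem, hz, mul_comm _ e, hz2]
      module
    have e4 : (s ^ 3 • e + z * z * z) * (s • e + z) = s ^ 4 • e + z * z * z * z := by
      simp only [add_mul, mul_add, smul_mul_assoc, mul_smul_comm, he.idem, hz, mul_comm _ e, hz3]
      module
    refine ⟨by simpa only [e2, e3] using linearize_four h2 hF h4 (s • e + z) u, ?_⟩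
    have := linearize_five h2 hF h5 (s • e + z) u
    rw [e2, e3, e4, mul_comm u, mul_comm _ (s ^ 2 • e + z * z), mul_comm _ (s • e + z),
      mul_comm _ (s • e + z)] at this
    exact this
  have a1 := hUZ hz hu
  have a2 := hUZ hz a1
  have a3 := hUZ hz a2
  have b1 := hUZ hz2 hu
  have b2 := hUZ hz b1
  have c1 := hUZ hz3 hu
  obtain ⟨G1, H1⟩ := H 1
  obtain ⟨G2, H2⟩ := H (-1)
  obtain ⟨-, H0⟩ := H 0
  simp only [add_mul, mul_add, smul_mul_assoc, mul_smul_comm, smul_add, smul_smul,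
    hu, a1, a2, a3, b1, b2, c1] at G1 G2 H1 H2 H0
  linear_combination (norm := skip) (1 : F) • H1 + (1 : F) • H2 - (2 : F) • H0 -
    (2⁻¹ : F) • G1 + (2⁻¹ : F) • G2
  match_scalars <;> field_simp <;> ring

theorem zero_mul_half_sq (he : IsHalfAxis F e) (h2 : (2 : F) ≠ 0) (hF : 3 < Cardinal.mk F)
    (h4 : ∀ x : A, (x * x) * (x * x) = ((x * x) * x) * x)
    {u z : A} (hu : e * u = (2⁻¹ : F) • u) (hz : e * z = 0) :
    z * (u * u) = (2 : F) • (u * (u * z) - e * (u * (u * z))) := by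
  obtain ⟨q, w, hw, huu⟩ := he.fusionUU u u hu hu
  have hv : e * (u * z) = (2⁻¹ : F) • (u * z) := he.fusionUZ _ _ hu hz
  have hwz : e * (w * z) = 0 := he.fusionZZ _ _ hw hz
  have H : ∀ s : F, (4 : F) • (((s ^ 2 + q) • e + s • u + w) * (u * z)) =
      s • (w * z) + (s ^ 2 + 2⁻¹ * q) • (u * z) + w * u * z +
      (s • e + u) * (s • (u * z) + w * z) + (2 : F) • ((s • e + u) * ((s • e + u) * (u * z))) := by
    intro s
    have e2 : (s • e + u) * (s • e + u) = (s ^ 2 + q) • e + s • u + w := by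
      simp only [add_mul, mul_add, smul_mul_assoc, mul_smul_comm, he.idem, hu, mul_comm u e, huu]
      match_scalars <;> field_simp <;> ring
    have e3 : ((s ^ 2 + q) • e + s • u + w) * (s • e + u) =
        (s * (s ^ 2 + 2 * q)) • e + (s ^ 2 + 2⁻¹ * q) • u + s • w + w * u := by
      simp only [add_mul, mul_add, smul_mul_assoc, mul_smul_comm, he.idem, hu, mul_comm u e, huu,
        mul_comm w e, hw]
      match_scalars <;> field_simp <;> ring
    have exz : (s • e + u) * z = u * z := by
      simp only [add_mul, smul_mul_assoc, hz]
      module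
    have := linearize_four h2 hF h4 (s • e + u) z
    rw [e2, e3, exz] at this
    rw [this]
    simp only [add_mul, smul_mul_assoc, hz, smul_zero, zero_add]
    module
  have H1 := H 1
  have H2 := H (-1)
  simp only [add_mul, mul_add, smul_mul_assoc, mul_smul_comm, smul_add, smul_smul, hv, hwz] at H1 H2
  rw [huu, mul_add, mul_smul_comm, mul_comm z e, hz, mul_comm z w]
  linear_combination (norm := skip) (-2⁻¹ : F) • H1 + (2⁻¹ : F) • H2
  match_scalars <;> field_simp <;> ring

theorem half_mul_zero_mul_zero (he : IsHalfAxis F e) (h2 : (2 : F) ≠ 0)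
    (hF : 3 < Cardinal.mk F)
    (h4 : ∀ x : A, (x * x) * (x * x) = ((x * x) * x) * x)
    (h5 : ∀ x : A, ((x * x) * x) * (x * x) = x * (((x * x) * x) * x))
    {u z t : A} (hu : e * u = (2⁻¹ : F) • u) (hz : e * z = 0) (ht : e * t = 0) :
    (z * t) * u = z * (t * u) + t * (z * u) := by
  have h := he.half_mul_zero_zero h2 hF h4 h5 hu (z := z + t) (by rw [mul_add, hz, ht, add_zero])
  have hzz := he.half_mul_zero_zero h2 hF h4 h5 hu hz
  have htt := he.half_mul_zero_zero h2 hF h4 h5 hu ht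
  simp only [add_mul, mul_add, smul_add, mul_comm t z] at h
  apply smul_right_injective A h2
  linear_combination (norm := module) h - hzz - htt

theorem zero_mul_half_mul_half (he : IsHalfAxis F e) (h2 : (2 : F) ≠ 0)
    (hF : 3 < Cardinal.mk F)
    (h4 : ∀ x : A, (x * x) * (x * x) = ((x * x) * x) * x)
    {u v z : A} (hu : e * u = (2⁻¹ : F) • u) (hv : e * v = (2⁻¹ : F) • v) (hz : e * z = 0) :
    z * (u * v) = u * (v * z) + v * (u * z) - e * (u * (v * z)) - e * (v * (u * z)) := by
  have h := he.zero_mul_half_sq h2 hF h4 (u := u + v) (by rw [mul_add, hu, hv, smul_add]) hz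
  have huu := he.zero_mul_half_sq h2 hF h4 hu hz
  have hvv := he.zero_mul_half_sq h2 hF h4 hv hz
  simp only [add_mul, mul_add, mul_comm v u] at h
  apply smul_right_injective A h2
  linear_combination (norm := module) h - huu - hvv

theorem decomp_unique (he : IsHalfAxis F e) {c c' : F} {u u' z z' : A}
    (hu : e * u = (2⁻¹ : F) • u) (hz : e * z = 0)
    (hu' : e * u' = (2⁻¹ : F) • u') (hz' : e * z' = 0)
    (h : c • e + u + z = c' • e + u' + z') : c = c' ∧ u = u' ∧ z = z' := by
  have := he.indep (c - c') (u - u') (z - z') (by rw [mul_sub, hu, hu', smul_sub])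
    (by rw [mul_sub, hz, hz', sub_zero])
    (by linear_combination (norm := module) h)
  exact ⟨sub_eq_zero.1 this.1, sub_eq_zero.1 this.2.1, sub_eq_zero.1 this.2.2⟩

theorem exists_coeff (he : IsHalfAxis F e) :
    ∃ φ : A →ₗ[F] F, ∀ (c : F) (u z : A), e * u = (2⁻¹ : F) • u → e * z = 0 →
      φ (c • e + u + z) = c := by
  choose c u z hu hz hx using he.decomp
  have huniq : ∀ (x : A) (c' : F) (u' z' : A), e * u' = (2⁻¹ : F) • u' → e * z' = 0 →
      x = c' • e + u' + z' → c x = c' := fun x c' u' z' hu' hz' h =>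
    (he.decomp_unique (hu x) (hz x) hu' hz' ((hx x).symm.trans h)).1
  refine ⟨{ toFun := c, map_add' := fun x y => ?_, map_smul' := fun r x => ?_ },
    fun d v t hv ht => huniq _ d v t hv ht rfl⟩
  · refine huniq _ _ (u x + u y) (z x + z y) (by rw [mul_add, hu, hu, smul_add])
      (by rw [mul_add, hz, hz, add_zero]) ?_
    linear_combination (norm := module) hx x + hx y
  · refine huniq _ _ (r • u x) (r • z x) (by rw [mul_smul_comm, hu, smul_comm])
      (by rw [mul_smul_comm, hz, smul_zero]) ?_
    rw [RingHom.id_apply, smul_eq_mul]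
    linear_combination (norm := module) r • hx x

/-- The coordinate along `e` in the Peirce decomposition of a half-axis `e`. -/
noncomputable def coeff (he : IsHalfAxis F e) : A →ₗ[F] F := he.exists_coeff.choose

theorem coeff_apply (he : IsHalfAxis F e) (c : F) {u z : A} (hu : e * u = (2⁻¹ : F) • u)
    (hz : e * z = 0) : he.coeff (c • e + u + z) = c :=
  he.exists_coeff.choose_spec c u z hu hz

theorem coeff_half (he : IsHalfAxis F e) {u : A} (hu : e * u = (2⁻¹ : F) • u) :
    he.coeff u = 0 := by
  simpa using he.coeff_apply 0 hu (mul_zero e)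

theorem coeff_zero (he : IsHalfAxis F e) {z : A} (hz : e * z = 0) : he.coeff z = 0 := by
  simpa using he.coeff_apply 0 (u := 0) (by simp) hz

theorem coeff_self (he : IsHalfAxis F e) : he.coeff e = 1 := by
  simpa using he.coeff_apply 1 (u := 0) (by simp) (mul_zero e)

theorem mul_half_mul_half (he : IsHalfAxis F e) {u v : A} (hu : e * u = (2⁻¹ : F) • u)
    (hv : e * v = (2⁻¹ : F) • v) : e * (u * v) = he.coeff (u * v) • e := by
  obtain ⟨c, z, hz, h⟩ := he.fusionUU u v hu hv
  rw [h, map_add, map_smul, he.coeff_self, he.coeff_zero hz, mul_add, hz, mul_smul_comm, he.idem]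
  simp

theorem coeff_mul_coeff (he : IsHalfAxis F e) (h2 : (2 : F) ≠ 0) {f : A} (hf : IsHalfAxis F f) :
    he.coeff f * hf.coeff e = he.coeff f * he.coeff f := by
  obtain ⟨c, u, z, hu, hz, hfd⟩ := he.decomp f
  obtain ⟨d, v, t, hv, ht, hed⟩ := hf.decomp e
  have hc : he.coeff f = c := by rw [hfd]; exact he.coeff_apply c hu hz
  have hd : hf.coeff e = d := by rw [hed]; exact hf.coeff_apply d hv ht
  rw [hc, hd]
  have h1 : (2 : F) • (f * (f * e)) = f * e + d • f := by
    rw [hed]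
    simp only [mul_add, mul_smul_comm, hf.idem, hv, ht, add_zero]
    match_scalars <;> field_simp <;> ring
  have hfe : f * e = c • e + (2⁻¹ : F) • u := by
    rw [mul_comm, hfd]
    simp only [mul_add, mul_smul_comm, he.idem, hu, hz, add_zero]
  have hzu : he.coeff (z * u) = 0 := by
    rw [mul_comm]; exact he.coeff_half (he.fusionUZ u z hu hz)
  have hff : c * c + he.coeff (u * u) = c := by
    have h := congrArg he.coeff hf.idem
    nth_rewrite 1 2 [hfd] at h
    simp only [add_mul, mul_add, smul_mul_assoc, mul_smul_comm, mul_comm _ e, mul_comm u z,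
      he.idem, hu, hz, map_add, map_smul, map_zero, he.coeff_self, he.coeff_half hu, hzu,
      he.coeff_zero (he.fusionZZ z z hz hz), hc, smul_eq_mul] at h
    linear_combination h
  have h3 := congrArg he.coeff h1
  rw [hfe] at h3
  nth_rewrite 1 [hfd] at h3
  simp only [add_mul, mul_add, smul_mul_assoc, mul_smul_comm, mul_comm _ e,
    he.idem, hu, hz, map_add, map_smul, map_zero, he.coeff_self, he.coeff_half hu, hzu,
    hc, smul_eq_mul] at h3
  field_simp at h3
  apply mul_left_cancel₀ h2
  linear_combination - h3 + 2 * hff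

theorem coeff_comm (he : IsHalfAxis F e) (h2 : (2 : F) ≠ 0) {f : A} (hf : IsHalfAxis F f) :
    he.coeff f = hf.coeff e := by
  have h1 := he.coeff_mul_coeff h2 hf
  have h3 := hf.coeff_mul_coeff h2 he
  have : (he.coeff f - hf.coeff e) ^ 2 = 0 := by linear_combination - h1 - h3
  exact sub_eq_zero.1 (pow_eq_zero_iff two_ne_zero |>.1 this)

theorem map (he : IsHalfAxis F e) (σ : A ≃ₗ[F] A) (hσ : ∀ x y, σ (x * y) = σ x * σ y) :
    IsHalfAxis F (σ e) := by
  have hmul : ∀ x y, σ.symm (x * y) = σ.symm x * σ.symm y := fun x y => by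
    rw [σ.symm_apply_eq, hσ, σ.apply_symm_apply, σ.apply_symm_apply]
  have hs : ∀ {y : A} {r : F}, σ e * y = r • y ↔ e * σ.symm y = r • σ.symm y := fun {y r} => by
    rw [← σ.symm.injective.eq_iff, hmul, map_smul, σ.symm_apply_apply]
  have hs0 : ∀ {y : A}, σ e * y = 0 ↔ e * σ.symm y = 0 := fun {y} => by
    simpa using hs (y := y) (r := 0)
  refine ⟨?_, ?_, ?_, ?_, ?_, ?_, ?_⟩
  · rw [← hσ, he.idem]
  · ext y
    have h := Set.ext_iff.1 he.eig_one (σ.symm y)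
    have h1 := hs (y := y) (r := 1)
    simp only [one_smul] at h1
    simp only [Set.mem_ofPred_eq] at h ⊢
    rw [h1, h]
    simp only [LinearEquiv.symm_apply_eq, map_smul]
  · intro x
    obtain ⟨c, u, z, hu, hz, hx⟩ := he.decomp (σ.symm x)
    refine ⟨c, σ u, σ z, by rw [hs]; simpa using hu, by rw [hs0]; simpa using hz, ?_⟩
    rw [LinearEquiv.symm_apply_eq] at hx
    simpa using hx
  · intro c u z hu hz h
    have := he.indep c _ _ (hs.1 hu) (hs0.1 hz)
      (by rw [← map_zero σ.symm, ← h]; simp)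
    simpa using this
  · intro z z' hz hz'
    rw [hs0, hmul]
    exact he.fusionZZ _ _ (hs0.1 hz) (hs0.1 hz')
  · intro u u' hu hu'
    obtain ⟨c, z, hz, h⟩ := he.fusionUU _ _ (hs.1 hu) (hs.1 hu')
    refine ⟨c, σ z, by rw [hs0]; simpa using hz, ?_⟩
    rw [← hmul, LinearEquiv.symm_apply_eq] at h
    simpa using h
  · intro u z hu hz
    rw [hs, hmul]
    exact he.fusionUZ _ _ (hs.1 hu) (hs0.1 hz)

theorem coeff_map (he : IsHalfAxis F e) (σ : A ≃ₗ[F] A) (hσ : ∀ x y, σ (x * y) = σ x * σ y)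
    (hσe : IsHalfAxis F (σ e)) (x : A) : hσe.coeff (σ x) = he.coeff x := by
  obtain ⟨c, u, z, hu, hz, rfl⟩ := he.decomp x
  rw [he.coeff_apply c hu hz, map_add σ, map_add σ, map_smul σ]
  exact hσe.coeff_apply c (by rw [← hσ, hu, map_smul]) (by rw [← hσ, hz, map_zero])

/-- The Miyamoto involution of a half-axis exists: an automorphism negating the half-eigenspace
and fixing the other two Peirce components. -/
theorem exists_miyamoto (he : IsHalfAxis F e) (h2 : (2 : F) ≠ 0) :
    ∃ τ : A ≃ₗ[F] A, (∀ x y, τ (x * y) = τ x * τ y) ∧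
      ∀ (c : F) (u z : A), e * u = (2⁻¹ : F) • u → e * z = 0 →
        τ (c • e + u + z) = c • e - u + z := by
  let T : A →ₗ[F] A := LinearMap.id - (4 : F) • LinearMap.mulLeft F e +
    (4 : F) • he.coeff.smulRight e
  have hT : ∀ (c : F) (u z : A), e * u = (2⁻¹ : F) • u → e * z = 0 →
      T (c • e + u + z) = c • e - u + z := by
    intro c u z hu hz
    simp only [T, LinearMap.add_apply, LinearMap.sub_apply, LinearMap.smul_apply,
      LinearMap.id_apply, LinearMap.mulLeft_apply, LinearMap.smulRight_apply,
      he.coeff_apply c hu hz, mul_add, mul_smul_comm, he.idem, hu, hz]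
    match_scalars <;> field_simp <;> ring
  have hneg : ∀ u : A, e * u = (2⁻¹ : F) • u → e * (-u) = (2⁻¹ : F) • (-u) := fun u hu => by
    rw [mul_neg, hu, smul_neg]
  have hinv : Function.Involutive T := by
    intro x
    obtain ⟨c, u, z, hu, hz, rfl⟩ := he.decomp x
    rw [hT c u z hu hz, sub_eq_add_neg, hT c (-u) z (hneg u hu) hz, sub_neg_eq_add]
  refine ⟨LinearEquiv.ofInvolutive T hinv, ?_, hT⟩
  intro x y
  change T (x * y) = T x * T y
  obtain ⟨c, u, z, hu, hz, rfl⟩ := he.decomp x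
  obtain ⟨d, v, t, hv, ht, rfl⟩ := he.decomp y
  obtain ⟨q, w, hw, huv⟩ := he.fusionUU u v hu hv
  have hut := he.fusionUZ u t hu ht
  have hvz := he.fusionUZ v z hv hz
  have hzt := he.fusionZZ z t hz ht
  have hprod : (c • e + u + z) * (d • e + v + t) = (c * d + q) • e +
      ((2⁻¹ * c) • v + (2⁻¹ * d) • u + u * t + v * z) + (w + z * t) := by
    simp only [add_mul, mul_add, smul_mul_assoc, mul_smul_comm, mul_comm _ e, he.idem, hu, hz,
      hv, ht, huv, mul_comm z v]
    module
  rw [hT c u z hu hz, hT d v t hv ht, hprod, hT]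
  · simp only [add_mul, mul_add, sub_mul, mul_sub, smul_mul_assoc, mul_smul_comm, mul_comm _ e,
      he.idem, hu, hz, hv, ht, huv, mul_comm z v]
    module
  · simp only [mul_add, mul_smul_comm, hu, hv, hut, hvz]
    module
  · rw [mul_add, hw, hzt, add_zero]

theorem mul_mem_span (he : IsHalfAxis F e) (h2 : (2 : F) ≠ 0) {x : A}
    (hx : x ∈ Submodule.span F {f : A | IsHalfAxis F f}) :
    e * x ∈ Submodule.span F {f : A | IsHalfAxis F f} := by
  induction hx using Submodule.span_induction with
  | mem f hf =>
    obtain ⟨τ, hmul, hτ⟩ := he.exists_miyamoto h2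
    have hτf : IsHalfAxis F (τ f) := IsHalfAxis.map hf τ hmul
    obtain ⟨c, u, z, hu, hz, hfd⟩ := he.decomp f
    have h : e * f = c • e + (2⁻¹ * 2⁻¹ : F) • (f - τ f) := by
      rw [hfd, hτ c u z hu hz]
      simp only [mul_add, mul_smul_comm, he.idem, hu, hz]
      match_scalars <;> field_simp <;> ring
    rw [h]
    exact add_mem (Submodule.smul_mem _ _ (Submodule.subset_span he))
      (Submodule.smul_mem _ _ (sub_mem (Submodule.subset_span hf) (Submodule.subset_span hτf)))
  | zero => rw [mul_zero]; exact zero_mem _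
  | add x y _ _ hx hy => rw [mul_add]; exact add_mem hx hy
  | smul r x _ hx => rw [mul_smul_comm]; exact Submodule.smul_mem _ _ hx

end IsHalfAxis

theorem span_halfAxis_eq_top (h2 : (2 : F) ≠ 0) {S : Set A}
    (hgen : NonUnitalAlgebra.adjoin F S = ⊤) (hax : ∀ e ∈ S, IsHalfAxis F e) :
    Submodule.span F {f : A | IsHalfAxis F f} = ⊤ := by
  rw [eq_top_iff]
  rintro x -
  have hx : x ∈ NonUnitalAlgebra.adjoin F S := hgen ▸ NonUnitalAlgebra.mem_top
  induction hx using NonUnitalAlgebra.adjoin_induction with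
  | mem e he => exact Submodule.subset_span (hax e he)
  | zero => exact zero_mem _
  | add x y _ _ hx hy => exact add_mem hx hy
  | smul r x _ hx => exact Submodule.smul_mem _ _ hx
  | mul x y _ _ hx hy =>
    clear * - hx hy h2
    induction hx using Submodule.span_induction with
    | mem e he => exact IsHalfAxis.mul_mem_span he h2 hy
    | zero => rw [zero_mul]; exact zero_mem _
    | add x y _ _ hx hy => rw [add_mul]; exact add_mem hx hy
    | smul r x _ hx => rw [smul_mul_assoc]; exact Submodule.smul_mem _ _ hx

theorem eq_zero_of_halfAxis {M : Type*} [AddCommGroup M] [Module F M]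
    (hspan : Submodule.span F {f : A | IsHalfAxis F f} = ⊤) (L : A →ₗ[F] M)
    (h : ∀ f, IsHalfAxis F f → L f = 0) (x : A) : L x = 0 := by
  have : L = 0 := LinearMap.ext_on hspan fun f hf => by simpa using h f hf
  simp [this]

/-- The projection form: the bilinear form whose value at a half-axis `e` and any `y` is the
coordinate of `y` along `e`. -/
theorem exists_projectionForm (h2 : (2 : F) ≠ 0)
    (hspan : Submodule.span F {f : A | IsHalfAxis F f} = ⊤) :
    ∃ B : A →ₗ[F] A →ₗ[F] F, ∀ (e : A) (he : IsHalfAxis F e) (x : A),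
      B e x = he.coeff x ∧ B x e = he.coeff x := by
  let b := Module.Basis.ofSpan hspan.ge
  have hb : ∀ i, IsHalfAxis F (b i) := fun i =>
    Module.Basis.ofSpan_subset hspan.ge (Set.mem_range_self i)
  let B : A →ₗ[F] A →ₗ[F] F := b.constr F fun i => (hb i).coeff
  have hB : ∀ i, B (b i) = (hb i).coeff := fun i => b.constr_basis F _ i
  have hright : ∀ (e : A) (he : IsHalfAxis F e) (x : A), B x e = he.coeff x := by
    intro e he x
    have : B.flip e = he.coeff := b.ext fun i => by
      rw [LinearMap.flip_apply, hB, (hb i).coeff_comm h2 he]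
    rw [← this, LinearMap.flip_apply]
  refine ⟨B, fun e he x => ⟨?_, hright e he x⟩⟩
  have : B e = he.coeff := LinearMap.ext_on hspan fun f hf => by
    rw [hright f hf, IsHalfAxis.coeff_comm hf h2 he]
  rw [this]

/-- The projection form associates with the product. -/
theorem exists_frobeniusForm (h2 : (2 : F) ≠ 0)
    (hspan : Submodule.span F {f : A | IsHalfAxis F f} = ⊤) :
    ∃ B : A →ₗ[F] A →ₗ[F] F, (∀ (e : A) (he : IsHalfAxis F e) (x : A), B e x = he.coeff x) ∧
      (∀ x y, B x y = B y x) ∧ ∀ x y z, B (x * y) z = B x (y * z) := by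
  obtain ⟨B, hB⟩ := exists_projectionForm h2 hspan
  have hsymm : ∀ x y, B x y = B y x := by
    intro x y
    have : B x - B.flip x = 0 := LinearMap.ext fun y => eq_zero_of_halfAxis hspan _
      (fun f hf => by simp [(hB f hf x).1, (hB f hf x).2]) y
    have h := LinearMap.congr_fun this y
    simpa [sub_eq_zero] using h
  have hauto : ∀ σ : A ≃ₗ[F] A, (∀ x y, σ (x * y) = σ x * σ y) → ∀ x y, B (σ x) (σ y) = B x y := by
    intro σ hσ x y
    have h := eq_zero_of_halfAxis hspan (B.compl₁₂ (σ : A →ₗ[F] A) (σ : A →ₗ[F] A) - B)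
      (fun f hf => LinearMap.ext fun y => by
        have hσf := IsHalfAxis.map hf σ hσ
        simp [(hB f hf y).1, (hB (σ f) hσf (σ y)).1, IsHalfAxis.coeff_map hf σ hσ hσf]) x
    simpa [sub_eq_zero] using LinearMap.congr_fun h y
  refine ⟨B, fun e he x => (hB e he x).1, hsymm, ?_⟩
  have horth : ∀ e : A, IsHalfAxis F e → ∀ u z : A, e * u = (2⁻¹ : F) • u → e * z = 0 →
      B u z = 0 := by
    intro e he u z hu hz
    obtain ⟨τ, hmul, hτ⟩ := he.exists_miyamoto h2
    have hτu : τ u = -u := by simpa using hτ 0 u 0 hu (mul_zero e)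
    have hτz : τ z = z := by simpa using hτ 0 0 z (by simp) hz
    have h := hauto τ hmul u z
    rw [hτu, hτz, map_neg, LinearMap.neg_apply] at h
    have : 2 * B u z = 0 := by linear_combination - h
    exact (mul_eq_zero.1 this).resolve_left h2
  have haxis : ∀ e : A, IsHalfAxis F e → ∀ x y, B (e * x) y = B x (e * y) := by
    intro e he x y
    obtain ⟨c, u, z, hu, hz, rfl⟩ := he.decomp x
    obtain ⟨d, v, t, hv, ht, rfl⟩ := he.decomp y
    simp only [mul_add, mul_smul_comm, he.idem, hu, hz, hv, ht, map_add, map_smul,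
      LinearMap.add_apply, LinearMap.smul_apply, (hB e he _).1, (hB e he _).2, he.coeff_self,
      he.coeff_half hu, he.coeff_half hv, he.coeff_zero hz, he.coeff_zero ht,
      horth e he u t hu ht, hsymm z v, horth e he v z hv hz, map_zero, LinearMap.zero_apply]
    simp
  intro x y z
  have h := eq_zero_of_halfAxis hspan
    ((B.flip z).comp (LinearMap.mulLeft F x) - (B x).comp (LinearMap.mulRight F z))
    (fun f hf => by simpa [sub_eq_zero, mul_comm x f] using haxis f hf x z) y
  simpa [sub_eq_zero] using h

/-- Self-adjointness of multiplication by an element of `A_0(e)` on `A_{1/2}(e)`. -/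
theorem IsHalfAxis.coeff_mul_half_assoc (he : IsHalfAxis F e) (h2 : (2 : F) ≠ 0)
    (hspan : Submodule.span F {f : A | IsHalfAxis F f} = ⊤) {u v : A}
    (hu : e * u = (2⁻¹ : F) • u) (hv : e * v = (2⁻¹ : F) • v) (z : A) :
    he.coeff ((u * z) * v) = he.coeff (u * (v * z)) := by
  obtain ⟨B, hB, hsymm, hassoc⟩ := exists_frobeniusForm h2 hspan
  rw [← hB, ← hB, mul_comm (u * z), ← hassoc e v, ← hassoc e u, hu, hv, map_smul, map_smul,
    LinearMap.smul_apply, LinearMap.smul_apply, ← hassoc v u, ← hassoc u v, mul_comm u v]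

section Jordan

/-- The complete linearization of the Jordan identity. -/
def jordanDefect (x y z w : A) : A :=
  ((x * y) * (z * w) - z * ((x * y) * w)) + ((y * z) * (x * w) - x * ((y * z) * w)) +
    ((z * x) * (y * w) - y * ((z * x) * w))

theorem jordanDefect_swap (x y z w : A) : jordanDefect x y z w = jordanDefect x z y w := by
  simp only [jordanDefect, mul_comm z y, mul_comm y x, mul_comm z x]
  abel

theorem jordanDefect_add (x y y' z w : A) :
    jordanDefect x (y + y') z w = jordanDefect x y z w + jordanDefect x y' z w := by
  simp only [jordanDefect, mul_add, add_mul]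
  abel

theorem jordanDefect_smul (c : F) (x y z w : A) :
    jordanDefect x (c • y) z w = c • jordanDefect x y z w := by
  simp only [jordanDefect, mul_smul_comm, smul_mul_assoc]
  module

namespace IsHalfAxis

theorem zero_mul_mul_comm (he : IsHalfAxis F e) {z : A} (hz : e * z = 0) (w : A) :
    z * (e * w) = e * (z * w) := by
  obtain ⟨c, u, t, hu, ht, rfl⟩ := he.decomp w
  have h1 := he.fusionUZ u z hu hz
  simp only [mul_add, mul_smul_comm, he.idem, hu, ht, mul_comm z e, hz, mul_comm z u, h1,
    he.fusionZZ z t hz ht, mul_zero, smul_zero]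

theorem half_mul_half_mul_comm (he : IsHalfAxis F e) {u v : A} (hu : e * u = (2⁻¹ : F) • u)
    (hv : e * v = (2⁻¹ : F) • v) (w : A) : (u * v) * (e * w) = e * ((u * v) * w) := by
  obtain ⟨c, z, hz, h⟩ := he.fusionUU u v hu hv
  rw [h, add_mul, add_mul, mul_add, he.zero_mul_mul_comm hz, smul_mul_assoc, smul_mul_assoc,
    mul_smul_comm]

theorem jordanDefect_half_zero (he : IsHalfAxis F e) (h2 : (2 : F) ≠ 0)
    (hF : 3 < Cardinal.mk F) (hspan : Submodule.span F {f : A | IsHalfAxis F f} = ⊤)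
    (h4 : ∀ x : A, (x * x) * (x * x) = ((x * x) * x) * x)
    (h5 : ∀ x : A, ((x * x) * x) * (x * x) = x * (((x * x) * x) * x))
    {u z : A} (hu : e * u = (2⁻¹ : F) • u) (hz : e * z = 0) (w : A) :
    jordanDefect e u z w = 0 := by
  have huz := he.fusionUZ u z hu hz
  obtain ⟨c, v, t, hv, ht, rfl⟩ := he.decomp w
  have huv := he.mul_half_mul_half huz hv
  have hvz := he.fusionUZ v z hv hz
  have huv' := he.mul_half_mul_half hu hvz
  have hvv := he.mul_half_mul_half hv huz
  have hA := he.half_mul_zero_mul_zero h2 hF h4 h5 hu hz ht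
  have hB := he.zero_mul_half_mul_half h2 hF h4 hu hv hz
  have hC := he.coeff_mul_half_assoc h2 hspan hu hv z
  have huzt := he.fusionUZ (u * z) t huz ht
  rw [huv', hvv, mul_comm v (u * z), hC] at hB
  rw [mul_comm (z * t) u, mul_comm t u, mul_comm t (z * u), mul_comm z u] at hA
  simp only [jordanDefect, mul_add, mul_smul_comm, smul_mul_assoc, mul_comm z e,
    mul_comm u e, mul_comm (u * z) e, mul_comm z v, mul_comm z u, he.idem,
    hu, hz, hv, ht, huz, hA, hB, huv, hC, huzt, zero_mul, mul_zero, smul_zero]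
  match_scalars <;> field_simp <;> ring

theorem jordanDefect_eq_zero (he : IsHalfAxis F e) (h2 : (2 : F) ≠ 0)
    (hF : 3 < Cardinal.mk F) (hspan : Submodule.span F {f : A | IsHalfAxis F f} = ⊤)
    (h4 : ∀ x : A, (x * x) * (x * x) = ((x * x) * x) * x)
    (h5 : ∀ x : A, ((x * x) * x) * (x * x) = x * (((x * x) * x) * x))
    (x y w : A) : jordanDefect e x y w = 0 := by
  have hself : ∀ y, jordanDefect e e y w = 0 := by
    intro y
    obtain ⟨d, v, t, hv, ht, rfl⟩ := he.decomp y
    have h := he.zero_mul_mul_comm ht w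
    rw [jordanDefect_swap, jordanDefect_add, jordanDefect_add, jordanDefect_smul]
    simp only [jordanDefect, mul_comm _ e, he.idem, hv, ht, h, smul_mul_assoc, mul_smul_comm,
      zero_mul, mul_zero]
    match_scalars <;> field_simp <;> ring
  have hmix := fun {u z : A} (hu : e * u = (2⁻¹ : F) • u) (hz : e * z = 0) =>
    he.jordanDefect_half_zero h2 hF hspan h4 h5 hu hz w
  obtain ⟨c, u, z, hu, hz, rfl⟩ := he.decomp x
  have hhalf : jordanDefect e u y w = 0 := by
    obtain ⟨d, v, t, hv, ht, rfl⟩ := he.decomp y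
    rw [jordanDefect_swap, jordanDefect_add, jordanDefect_add, jordanDefect_smul, hself,
      jordanDefect_swap e t, hmix hu ht, smul_zero, zero_add, add_zero, jordanDefect]
    simp only [mul_comm _ e, hu, hv, smul_mul_assoc, mul_smul_comm,
      he.half_mul_half_mul_comm hv hu]
    abel
  have hzero : jordanDefect e z y w = 0 := by
    obtain ⟨d, v, t, hv, ht, rfl⟩ := he.decomp y
    rw [jordanDefect_swap, jordanDefect_add, jordanDefect_add, jordanDefect_smul, hself,
      hmix hv hz, smul_zero, zero_add, zero_add, jordanDefect]
    simp only [mul_comm _ e, hz, ht, zero_mul, mul_zero,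
      he.zero_mul_mul_comm (he.fusionZZ t z ht hz)]
    abel
  rw [jordanDefect_add, jordanDefect_add, jordanDefect_smul, hself, hhalf, hzero]
  simp

end IsHalfAxis

theorem jordan_of_jordanDefect_eq_zero
    (hspan : Submodule.span F {f : A | IsHalfAxis F f} = ⊤)
    (h : ∀ e : A, IsHalfAxis F e → ∀ x y w, jordanDefect e x y w = 0) (x w : A) :
    (x * x) * (x * w) = x * ((x * x) * w) := by
  have hrot : ∀ a x y w : A, jordanDefect x a y w = jordanDefect a x y w := fun a x y w => by
    simp only [jordanDefect, mul_comm y a, mul_comm x a, mul_comm y x]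
    abel
  have hall : ∀ a x y w : A, jordanDefect a x y w = 0 := by
    intro a x y w
    rw [← hrot]
    have ha : a ∈ Submodule.span F {f : A | IsHalfAxis F f} := hspan ▸ Submodule.mem_top
    induction ha using Submodule.span_induction with
    | mem e he => rw [hrot]; exact h e he x y w
    | zero => simp [jordanDefect]
    | add a b _ _ ha hb => rw [jordanDefect_add, ha, hb, add_zero]
    | smul r a _ ha => rw [jordanDefect_smul, ha, smul_zero]
  have hx : x ∈ Submodule.span F {f : A | IsHalfAxis F f} := hspan ▸ Submodule.mem_top
  induction hx using Submodule.span_induction with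
  | mem e he => rw [IsHalfAxis.idem he]
  | zero => simp
  | add x y _ _ hx hy =>
    have h1 := hall x x y w
    have h3 := hall y y x w
    simp only [jordanDefect, mul_comm y x] at h1 h3
    simp only [mul_add, add_mul, mul_comm y x]
    linear_combination (norm := module) hx + hy + h1 + h3
  | smul r x _ hx => simp only [smul_mul_assoc, mul_smul_comm, hx]

end Jordan

end Peirce

theorem stmt1 {F : Type*} [Field F] {A : Type*} [NonUnitalNonAssocCommRing A]
    [Module F A] [SMulCommClass F A A] [IsScalarTower F A A]
    (h2 : (2 : F) ≠ 0) (hF : 3 < Cardinal.mk F)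
    (𝒜 : Set A) (hgen : NonUnitalAlgebra.adjoin F 𝒜 = ⊤)
    (hax : ∀ e ∈ 𝒜, IsHalfAxis F e) :
    (∀ x y : A, (x * y) * (x * x) = x * (y * (x * x))) ↔
      (∀ x : A, (x * x) * (x * x) = ((x * x) * x) * x ∧
        ((x * x) * x) * (x * x) = x * (((x * x) * x) * x)) := by
  constructor
  · intro hJ x
    have h4 : (x * x) * (x * x) = ((x * x) * x) * x := by
      rw [hJ x x, mul_comm x, mul_comm x (x * x)]
    refine ⟨h4, ?_⟩
    rw [← h4, mul_comm (x * x) x, hJ x (x * x)]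
  · intro hid x y
    have h4 := fun x => (hid x).1
    have h5 := fun x => (hid x).2
    have hspan := span_halfAxis_eq_top h2 hgen hax
    rw [mul_comm (x * y), mul_comm y]
    exact jordan_of_jordanDefect_eq_zero hspan
      (fun e he => he.jordanDefect_eq_zero h2 hF hspan h4 h5) x y
end

section
/- Let e ∈ A be a half-axis and u₁, u₂ ∈ U := A_{1/2}(e); write u₁² = δ₁e + z₁ and u₁u₂ = δ₁₂e + z₁₂ with δ₁, δ₁₂ ∈ 𝔽 and z₁, z₁₂ ∈ Z := A_0(e). Then: (a) u₁²u₂ − δ₁₂u₁ − δ₁u₂ + 2u₁z₁₂ = 0; (b) 2u₁(u₁u₂) = −u₁²u₂ + δ₁u₂ + 2δ₁₂u₁; (c) u₂z₁ − δ₁₂u₁ − (1/2)δ₁u₂ + 2u₁z₁₂ = 0; (d) 2(u₁z₁₂)z₁ = (1/2)δ₁₂δ₁u₁; (e) 2(u₁(u₁u₂))z₁ = δ₁₂δ₁u₁. -/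
section Polarization

variable {A : Type*} [NonUnitalNonAssocCommRing A]

theorem polarize_four_odd (h2 : ∀ x : A, x + x = 0 → x = 0)
    (hid : ∀ x : A, (x * x) * (x * x) = ((x * x) * x) * x) (a b c : A) :
    4 • ((a * b) * (c * c)) + 8 • ((a * c) * (b * c)) =
      2 • (((a * b) * c) * c) + 2 • (((a * c) * b) * c) + 2 • (((a * c) * c) * b) +
      2 • (((b * c) * a) * c) + 2 • (((b * c) * c) * a) +
      ((c * c) * a) * b + ((c * c) * b) * a := by
  rw [← sub_eq_zero]
  apply h2; apply h2
  have e1 := hid (a + b + c)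
  have e2 := hid (a - b + c)
  have e3 := hid (a + b - c)
  have e4 := hid (a - b - c)
  have e5 := hid (a + b)
  have e6 := hid (a - b)
  simp only [mul_add, add_mul, mul_sub, mul_comm] at e1 e2 e3 e4 e5 e6 ⊢
  rw [← sub_eq_zero] at e1 e2 e3 e4 e5 e6
  have key :=
    congrArg₂ (· - ·) (congrArg₂ (· + ·) (congrArg₂ (· - ·) e1 e2) (congrArg₂ (· - ·) e3
      e4)) (congrArg (2 • ·) (congrArg₂ (· - ·) e5 e6))
  simp only [sub_zero, add_zero, smul_zero] at key
  rw [← key]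
  abel


set_option maxHeartbeats 4000000 in
theorem polarize_five_even (h2 : ∀ x : A, x + x = 0 → x = 0)
    (hid : ∀ x : A, ((x * x) * x) * (x * x) = x * (((x * x) * x) * x)) (a b c : A) :
    (((a * a) * b) * (c * c)) + 2 • (((a * a) * c) * (b * c)) + 2 • (((a * b) * a) * (c * c)) +
      4 • (((a * b) * c) * (a * c)) + 4 • (((a * c) * a) * (b * c)) +
      4 • (((a * c) * b) * (a * c)) + 4 • (((a * c) * c) * (a * b)) +
      4 • (((b * c) * a) * (a * c)) + 2 • (((b * c) * c) * (a * a)) +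
      2 • (((c * c) * a) * (a * b)) + (((c * c) * b) * (a * a)) =
    ((((a * a) * b) * c) * c) + ((((a * a) * c) * b) * c) + ((((a * a) * c) * c) * b) +
      2 • ((((a * b) * a) * c) * c) + 2 • ((((a * b) * c) * a) * c) +
      2 • ((((a * b) * c) * c) * a) + 2 • ((((a * c) * a) * b) * c) +
      2 • ((((a * c) * a) * c) * b) + 2 • ((((a * c) * b) * a) * c) +
      2 • ((((a * c) * b) * c) * a) + 2 • ((((a * c) * c) * a) * b) +
      2 • ((((a * c) * c) * b) * a) + 2 • ((((b * c) * a) * a) * c) +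
      2 • ((((b * c) * a) * c) * a) + 2 • ((((b * c) * c) * a) * a) + ((((c * c) * a) * a) * b) +
      ((((c * c) * a) * b) * a) + ((((c * c) * b) * a) * a) := by
  rw [← sub_eq_zero]
  apply h2; apply h2
  have e1 := hid (a + b + c)
  have e2 := hid (a - b + c)
  have e3 := hid (a + b - c)
  have e4 := hid (a - b - c)
  have e5 := hid (a + b)
  have e6 := hid (a - b)
  have e7 := hid (b + c)
  have e8 := hid (c - b)
  have e9 := hid b
  rw [← sub_eq_zero] at e1 e2 e3 e4 e5 e6 e7 e8 e9
  simp only [mul_add, add_mul, mul_sub, mul_comm] at e1 e2 e3 e4 e5 e6 e7 e8 e9 ⊢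
  have key :=
    congrArg₂ (· + ·) (congrArg₂ (· - ·) (congrArg₂ (· + ·) (congrArg₂ (· - ·) e1 e2)
      (congrArg₂ (· - ·) e3 e4)) (congrArg (2 • ·) (congrArg₂ (· + ·) (congrArg₂ (· - ·) e5
      e6) (congrArg₂ (· - ·) e7 e8)))) (congrArg (4 • ·) e9)
  simp only [sub_zero, add_zero, smul_zero] at key
  rw [← key]
  abel

end Polarization

namespace IsHalfAxis

variable {F : Type*} [Field F] {A : Type*} [NonUnitalNonAssocCommRing A]
  [Module F A] [SMulCommClass F A A] [IsScalarTower F A A] {e u z : A}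

theorem mul_mul_self_eq (h2 : (2 : F) ≠ 0)
    (hid1 : ∀ x : A, (x * x) * (x * x) = ((x * x) * x) * x)
    (hid2 : ∀ x : A, ((x * x) * x) * (x * x) = x * (((x * x) * x) * x))
    (he : IsHalfAxis F e) (hu : e * u = (2⁻¹ : F) • u) (hz : e * z = 0) :
    u * (z * z) = (2 : F) • ((u * z) * z) := by
  have h2A : ∀ x : A, x + x = 0 → x = 0 := fun x hx => by
    rw [← two_smul F] at hx
    exact (smul_eq_zero.1 hx).resolve_left h2
  have hzz := he.fusionZZ z z hz hz
  have hp := he.fusionUZ u z hu hz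
  have hq := he.fusionUZ u (z * z) hu hzz
  have hr := he.fusionUZ (u * z) z hp hz
  have he' := he.idem
  have E1 := polarize_four_odd h2A hid1 e u z
  have E2 := polarize_five_even h2A hid2 e u z
  rw [mul_comm u (z * z)] at hq ⊢
  have c1 := mul_comm u e
  have c3 := mul_comm (u * z) e
  have c4 := mul_comm (z * z * u) e
  have c5 := mul_comm (u * z * z) e
  have c6 := mul_comm (z * z) e
  rw [hu] at c1
  rw [hp] at c3
  rw [hq] at c4
  rw [hr] at c5
  rw [hzz] at c6
  have c7 := mul_comm u (z * z)
  simp only [hu, hz, he', c1, c3, c4, c5, c6, c7, smul_mul_assoc,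
    mul_smul_comm, zero_mul, mul_zero, smul_zero, add_zero] at E1 E2
  linear_combination (norm := skip) 2 • E2 - E1
  match_scalars <;> field_simp <;> ring

theorem mul_of_mul_self (h2 : (2 : F) ≠ 0)
    (hid1 : ∀ x : A, (x * x) * (x * x) = ((x * x) * x) * x)
    (he : IsHalfAxis F e) (hu : e * u = (2⁻¹ : F) • u) (hz : e * z = 0) {δ : F}
    (hd : u * u = δ • e + z) :
    u * z = ((2⁻¹ : F) * δ) • u := by
  have hp := he.fusionUZ u z hu hz
  have he' := he.idem
  have c1 := mul_comm u e
  have c2 := mul_comm z e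
  have c3 := mul_comm (u * z) e
  have c4 := mul_comm z u
  rw [hu] at c1
  rw [hz] at c2
  rw [hp] at c3
  have E1 := hid1 (e + u)
  have E2 := hid1 (e - u)
  simp only [mul_add, add_mul, mul_sub, sub_mul, hu, hz, he', hd, c1, c2, c3, c4, smul_mul_assoc,
    mul_smul_comm, smul_zero, add_zero, zero_add] at E1 E2
  linear_combination (norm := skip) E1 - E2
  match_scalars <;> field_simp <;> ring

theorem mul_self_of_mul_self (h2 : (2 : F) ≠ 0)
    (hid1 : ∀ x : A, (x * x) * (x * x) = ((x * x) * x) * x)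
    (he : IsHalfAxis F e) (hu : e * u = (2⁻¹ : F) • u) (hz : e * z = 0) {δ : F}
    (hd : u * u = δ • e + z) :
    z * z = δ • z := by
  have hp := he.mul_of_mul_self h2 hid1 hu hz hd
  have E1 := hid1 u
  have he' := he.idem
  have c1 := mul_comm z e
  have c2 := mul_comm z u
  rw [hz] at c1
  rw [hp] at c2
  simp only [add_mul, mul_add, hd, hu, hz, he', c1, c2, smul_mul_assoc, mul_smul_comm,
    smul_zero, add_zero, zero_add] at E1
  linear_combination (norm := skip) E1
  match_scalars <;> field_simp <;> ring

theorem mul_self_mul_add (h2 : (2 : F) ≠ 0)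
    (hid1 : ∀ x : A, (x * x) * (x * x) = ((x * x) * x) * x)
    (he : IsHalfAxis F e) {u₁ u₂ : A}
    (hu₁ : e * u₁ = (2⁻¹ : F) • u₁) (hu₂ : e * u₂ = (2⁻¹ : F) • u₂)
    {δ₁ δ₁₂ : F} {z₁ z₁₂ : A} (hz₁ : e * z₁ = 0) (hz₁₂ : e * z₁₂ = 0)
    (hdec1 : u₁ * u₁ = δ₁ • e + z₁) (hdec12 : u₁ * u₂ = δ₁₂ • e + z₁₂) :
    u₂ * z₁ + (2 : F) • (u₁ * z₁₂) = δ₁₂ • u₁ + ((2⁻¹ : F) * δ₁) • u₂ := by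
  obtain ⟨δ₂, z₂, hz₂, hdec2⟩ := he.fusionUU u₂ u₂ hu₂ hu₂
  have E2 := he.mul_of_mul_self h2 hid1 hu₂ hz₂ hdec2
  have Ep := he.mul_of_mul_self (u := u₁ + u₂) (z := z₁ + (2 : F) • z₁₂ + z₂)
    (δ := δ₁ + 2 * δ₁₂ + δ₂) h2 hid1
    (by rw [mul_add, hu₁, hu₂, smul_add])
    (by simp only [mul_add, mul_smul_comm, hz₁, hz₁₂, hz₂, smul_zero, add_zero])
    (by simp only [mul_add, add_mul, mul_comm u₂ u₁, hdec1, hdec12, hdec2]; module)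
  have Em := he.mul_of_mul_self (u := u₁ - u₂) (z := z₁ - (2 : F) • z₁₂ + z₂)
    (δ := δ₁ - 2 * δ₁₂ + δ₂) h2 hid1
    (by rw [mul_sub, hu₁, hu₂, smul_sub])
    (by simp only [mul_add, mul_sub, mul_smul_comm, hz₁, hz₁₂, hz₂, smul_zero, add_zero, sub_zero])
    (by simp only [mul_sub, sub_mul, mul_comm u₂ u₁, hdec1, hdec12, hdec2]; module)
  simp only [mul_add, mul_sub, add_mul, sub_mul, mul_smul_comm] at Ep Em
  linear_combination (norm := skip) (2⁻¹ : F) • (Ep - Em) - E2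
  match_scalars <;> field_simp <;> ring

end IsHalfAxis

theorem stmt9 {F : Type*} [Field F] {A : Type*} [NonUnitalNonAssocCommRing A]
    [Module F A] [SMulCommClass F A A] [IsScalarTower F A A]
    (h2 : (2 : F) ≠ 0) (hF : 3 < Cardinal.mk F)
    (hid1 : ∀ x : A, (x * x) * (x * x) = ((x * x) * x) * x)
    (hid2 : ∀ x : A, ((x * x) * x) * (x * x) = x * (((x * x) * x) * x))
    (e : A) (he : IsHalfAxis F e)
    (u₁ u₂ : A) (hu₁ : e * u₁ = (2⁻¹ : F) • u₁) (hu₂ : e * u₂ = (2⁻¹ : F) • u₂)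
    (δ₁ δ₁₂ : F) (z₁ z₁₂ : A) (hz₁ : e * z₁ = 0) (hz₁₂ : e * z₁₂ = 0)
    (hdec1 : u₁ * u₁ = δ₁ • e + z₁) (hdec12 : u₁ * u₂ = δ₁₂ • e + z₁₂) :
    ((u₁ * u₁) * u₂ - δ₁₂ • u₁ - δ₁ • u₂ + (2 : F) • (u₁ * z₁₂) = 0) ∧
    ((2 : F) • (u₁ * (u₁ * u₂)) = -((u₁ * u₁) * u₂) + δ₁ • u₂ + (2 * δ₁₂) • u₁) ∧
    (u₂ * z₁ - δ₁₂ • u₁ - ((2⁻¹ : F) * δ₁) • u₂ + (2 : F) • (u₁ * z₁₂) = 0) ∧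
    ((2 : F) • ((u₁ * z₁₂) * z₁) = ((2⁻¹ : F) * δ₁₂ * δ₁) • u₁) ∧
    ((2 : F) • ((u₁ * (u₁ * u₂)) * z₁) = (δ₁₂ * δ₁) • u₁) := by
  have hp := he.mul_of_mul_self h2 hid1 hu₁ hz₁ hdec1
  have hzz := he.mul_self_of_mul_self h2 hid1 hu₁ hz₁ hdec1
  have hlin := he.mul_self_mul_add h2 hid1 hu₁ hu₂ hz₁ hz₁₂ hdec1 hdec12
  have hsq := he.mul_mul_self_eq h2 hid1 hid2 hu₂ hz₁
  have hu₁e : u₁ * e = (2⁻¹ : F) • u₁ := by rw [mul_comm, hu₁]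
  have hlinz := congrArg (· * z₁) hlin
  simp only [add_mul, smul_mul_assoc, hp] at hlinz
  rw [hzz, mul_smul_comm] at hsq
  have hd : (2 : F) • ((u₁ * z₁₂) * z₁) = ((2⁻¹ : F) * δ₁₂ * δ₁) • u₁ := by
    linear_combination (norm := skip) hlinz + (2⁻¹ : F) • hsq
    match_scalars <;> field_simp <;> ring
  simp only [hdec1, hdec12, add_mul, mul_add, smul_mul_assoc, mul_smul_comm, hu₂, hu₁e, hp,
    mul_comm z₁ u₂]
  refine ⟨?_, ?_, ?_, hd, ?_⟩
  · linear_combination (norm := skip) hlin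
    match_scalars <;> field_simp <;> ring
  · linear_combination (norm := skip) hlin
    match_scalars <;> field_simp <;> ring
  · linear_combination (norm := module) hlin
  · linear_combination (norm := skip) hd
    match_scalars <;> field_simp <;> ring
end

section
/- Let e ∈ A be a half-axis and u₁, u₂ ∈ U := A_{1/2}(e), and assume u₁² ∉ Z := A_0(e). Then u₁²(u₁u₂) = u₁(u₁²u₂). -/
section Linearization

variable {F : Type*} [Field F]

/-- A field with more than three elements contains `t ≠ 0` with `t ^ 2 ≠ 1`. -/
theorem exists_sq_ne_one (hF : 3 < Cardinal.mk F) : ∃ t : F, t ≠ 0 ∧ t ^ 2 - 1 ≠ 0 := by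
  classical
  by_contra! h
  have hsub : ∀ t : F, t ∈ ({0, 1, -1} : Finset F) := by
    intro t
    by_cases ht : t = 0
    · simp [ht]
    · have h1 : (t - 1) * (t + 1) = 0 := by linear_combination h t ht
      rcases mul_eq_zero.mp h1 with h1 | h1
      · simp [sub_eq_zero.mp h1]
      · simp [eq_neg_of_add_eq_zero_left h1]
  have hcard : Cardinal.mk F ≤ 3 := by
    rw [← Cardinal.mk_univ, ← Set.eq_univ_of_forall (s := (({0, 1, -1} : Finset F) : Set F)) hsub]
    exact Cardinal.mk_coe_finset.trans_le (by exact_mod_cast Finset.card_le_three)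
  exact absurd hF (not_lt.mpr hcard)

/-- The linear coefficient of a quartic polynomial function without constant term that vanishes
identically is zero, over a field of characteristic not `2` with more than three elements. -/
theorem linear_coeff_eq_zero {M : Type*} [AddCommGroup M] [Module F M]
    (h2 : (2 : F) ≠ 0) (hF : 3 < Cardinal.mk F) {c₁ c₂ c₃ c₄ : M}
    (h : ∀ t : F, t • c₁ + t ^ 2 • c₂ + t ^ 3 • c₃ + t ^ 4 • c₄ = 0) : c₁ = 0 := by
  obtain ⟨t, ht0, ht1⟩ := exists_sq_ne_one hF
  have hodd : ∀ s : F, (2 * s) • (c₁ + s ^ 2 • c₃) = 0 := fun s => by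
    linear_combination (norm := module) h s - h (-s)
  have h1 : c₁ + (1 : F) ^ 2 • c₃ = 0 :=
    (smul_eq_zero.mp (hodd 1)).resolve_left (by simpa using h2)
  have ht : c₁ + t ^ 2 • c₃ = 0 :=
    (smul_eq_zero.mp (hodd t)).resolve_left (mul_ne_zero h2 ht0)
  have h3 : (t ^ 2 - 1) • c₁ = 0 := by
    linear_combination (norm := module) t ^ 2 • h1 - ht
  exact (smul_eq_zero.mp h3).resolve_left ht1

variable {A : Type*} [NonUnitalNonAssocCommRing A]
  [Module F A] [SMulCommClass F A A] [IsScalarTower F A A]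

/-- Linearization of `x²x² = x³x`. -/
theorem linearized_quartic (h2 : (2 : F) ≠ 0) (hF : 3 < Cardinal.mk F)
    (hid : ∀ x : A, (x * x) * (x * x) = ((x * x) * x) * x) (x h : A) :
    (4 : F) • ((x * x) * (x * h)) =
      ((2 : F) • ((x * h) * x) + (x * x) * h) * x + ((x * x) * x) * h := by
  rw [← sub_eq_zero]
  refine linear_coeff_eq_zero h2 hF
    (c₂ := (4 : F) • ((x * h) * (x * h)) + (2 : F) • ((x * x) * (h * h))
      - (((h * h) * x + (2 : F) • ((x * h) * h)) * x
        + ((2 : F) • ((x * h) * x) + (x * x) * h) * h))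
    (c₃ := (4 : F) • ((h * h) * (x * h))
      - (((h * h) * h) * x + ((h * h) * x + (2 : F) • ((x * h) * h)) * h))
    (c₄ := 0) fun t => ?_
  have ht := hid (x + t • h)
  have hx := hid x
  have hh := hid h
  have c1 := mul_comm h x
  have c2 := mul_comm (x * h) (x * x)
  have c3 := mul_comm (h * h) (x * x)
  have c4 := mul_comm (h * h) (x * h)
  simp only [mul_add, add_mul, smul_mul_assoc, mul_smul_comm, smul_add, smul_smul,
    c1, c2, c3, c4] at ht ⊢
  linear_combination (norm := module) ht - hx - t ^ 4 • hh

/-- Linearization of `x³x² = x(x²x²)`. -/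
theorem linearized_quintic (h2 : (2 : F) ≠ 0) (hF : 3 < Cardinal.mk F)
    (hid : ∀ x : A, ((x * x) * x) * (x * x) = x * ((x * x) * (x * x))) (x h : A) :
    ((2 : F) • ((x * h) * x) + (x * x) * h) * (x * x) + (2 : F) • (((x * x) * x) * (x * h)) =
      h * ((x * x) * (x * x)) + (4 : F) • (x * ((x * x) * (x * h))) := by
  rw [← sub_eq_zero]
  let s₁ := (2 : F) • (x * h)
  let k₁ := s₁ * x + (x * x) * h
  let k₂ := (h * h) * x + s₁ * h
  let f₁ := (2 : F) • ((x * x) * s₁)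
  let f₂ := (2 : F) • ((x * x) * (h * h)) + s₁ * s₁
  let f₃ := (2 : F) • (s₁ * (h * h))
  refine linear_coeff_eq_zero h2 hF
    (c₂ := k₂ * (x * x) + k₁ * s₁ + ((x * x) * x) * (h * h) - (x * f₂ + h * f₁))
    (c₃ := ((h * h) * h) * (x * x) + k₂ * s₁ + k₁ * (h * h) - (x * f₃ + h * f₂))
    (c₄ := ((h * h) * h) * s₁ + k₂ * (h * h) - (x * ((h * h) * (h * h)) + h * f₃)) fun t => ?_
  have ht := hid (x + t • h)
  have hx := hid x
  have hh := hid h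
  have c1 := mul_comm h x
  have c2 := mul_comm (x * h) (x * x)
  have c3 := mul_comm (h * h) (x * x)
  have c4 := mul_comm (h * h) (x * h)
  simp only [s₁, k₁, k₂, f₁, f₂, f₃, mul_add, add_mul, smul_mul_assoc, mul_smul_comm, smul_add,
    smul_smul, c1, c2, c3, c4] at ht ⊢
  linear_combination (norm := module) ht - hx - t ^ 5 • hh

end Linearization

namespace IsHalfAxis

variable {F : Type*} [Field F] {A : Type*} [NonUnitalNonAssocCommRing A]
  [Module F A] [SMulCommClass F A A] [IsScalarTower F A A] {e : A}

/-- The cube of `u ∈ A_{1/2}(e)` is the `e`-coefficient of `u²` times `u`. -/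
theorem cube_eq (he : IsHalfAxis F e) (h2 : (2 : F) ≠ 0) (hF : 3 < Cardinal.mk F)
    (hid : ∀ x : A, (x * x) * (x * x) = ((x * x) * x) * x)
    {u z : A} {α : F} (hu : e * u = (2⁻¹ : F) • u) (hz : e * z = 0) (huu : u * u = α • e + z) :
    (u * u) * u = α • u := by
  have hL := linearized_quartic h2 hF hid u e
  have hue : u * e = (2⁻¹ : F) • u := by rw [mul_comm, hu]
  have hze : z * e = 0 := by rw [mul_comm, hz]
  have huz : e * (u * z) = (2⁻¹ : F) • (u * z) := he.fusionUZ u z hu hz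
  have c1 := mul_comm z u
  have c2 := mul_comm (u * z) e
  simp only [huu, add_mul, smul_mul_assoc, mul_smul_comm, hue, hu, hze, he.idem,
    c1, c2, huz, smul_add, smul_smul, add_zero] at hL ⊢
  linear_combination (norm := (match_scalars <;> clear * - h2 <;> grind))
    (2 : F) • hL

/-- Polarization of `cube_eq`. -/
theorem cube_polarized (he : IsHalfAxis F e) (h2 : (2 : F) ≠ 0) (hF : 3 < Cardinal.mk F)
    (hid : ∀ x : A, (x * x) * (x * x) = ((x * x) * x) * x)
    {u v z w : A} {α β : F} (hu : e * u = (2⁻¹ : F) • u) (hv : e * v = (2⁻¹ : F) • v)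
    (hz : e * z = 0) (huu : u * u = α • e + z) (hw : e * w = 0) (huv : u * v = β • e + w) :
    (u * u) * v + (2 : F) • (u * (u * v)) = α • v + (2 * β) • u := by
  obtain ⟨γ, y, hy, hvv⟩ := he.fusionUU v v hv hv
  have hvu : v * u = β • e + w := by rw [mul_comm, huv]
  have hp := cube_eq he h2 hF hid (u := u + v) (z := z + (2 : F) • w + y) (α := α + 2 * β + γ)
    (by rw [mul_add, hu, hv, smul_add])
    (by simp only [mul_add, mul_smul_comm, hz, hw, hy, smul_zero, add_zero])
    (by simp only [mul_add, add_mul, huu, huv, hvu, hvv]; module)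
  have hm := cube_eq he h2 hF hid (u := u - v) (z := z - (2 : F) • w + y) (α := α - 2 * β + γ)
    (by rw [mul_sub, hu, hv, smul_sub])
    (by simp only [mul_add, mul_sub, mul_smul_comm, hz, hw, hy, smul_zero, add_zero, sub_zero])
    (by simp only [mul_sub, sub_mul, huu, huv, hvu, hvv]; module)
  have hv3 := cube_eq he h2 hF hid hv hy hvv
  have c1 := mul_comm v u
  have c2 := mul_comm (u * v) u
  simp only [mul_sub, sub_mul, mul_add, add_mul, c1, c2] at hp hm
  linear_combination (norm := (match_scalars <;> clear * - h2 <;> grind))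
    (2⁻¹ : F) • hp - (2⁻¹ : F) • hm - hv3

/-- For `u ∈ A_{1/2}(e)` and `y ∈ A_0(e)`, the component of `u(uy)` in `A_0(e)` is half of that
of `u²`, times `y`. -/
theorem mul_mul_zero_part (he : IsHalfAxis F e) (h2 : (2 : F) ≠ 0) (hF : 3 < Cardinal.mk F)
    (hid : ∀ x : A, (x * x) * (x * x) = ((x * x) * x) * x)
    {u y z r : A} {α γ : F} (hu : e * u = (2⁻¹ : F) • u) (hy : e * y = 0)
    (hz : e * z = 0) (huu : u * u = α • e + z)
    (hr : e * r = 0) (hur : u * (u * y) = γ • e + r) :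
    (2 : F) • r = z * y := by
  have hp := linearized_quartic h2 hF hid (e + u) y
  have hm := linearized_quartic h2 hF hid (e - u) y
  have hue : u * e = (2⁻¹ : F) • u := by rw [mul_comm, hu]
  have hze : z * e = 0 := by rw [mul_comm, hz]
  have huye : e * (u * y) = (2⁻¹ : F) • (u * y) := he.fusionUZ u y hu hy
  have huye' : (u * y) * e = (2⁻¹ : F) • (u * y) := by rw [mul_comm, huye]
  have huyu : (u * y) * u = γ • e + r := by rw [mul_comm, hur]
  have hzye : (z * y) * e = 0 := by rw [mul_comm, he.fusionZZ z y hz hy]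
  have hre : r * e = 0 := by rw [mul_comm, hr]
  simp only [huu, mul_sub, sub_mul, mul_add, add_mul, smul_mul_assoc, hue, hu,
    hze, hy, he.idem, huye, huye', hur, huyu, hzye, hre, smul_add, smul_sub, smul_smul, smul_zero,
    add_zero, zero_add, sub_zero, zero_sub, neg_mul, mul_neg, smul_neg] at hp hm
  linear_combination (norm := (match_scalars <;> clear * - h2 <;> grind))
    (2⁻¹ : F) • hp + (2⁻¹ : F) • hm

/-- Multiplication of `u ∈ A_{1/2}(e)` by `y² ∈ A_0(e)` is twice the iterated
multiplication by `y`. -/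
theorem mul_sq (he : IsHalfAxis F e) (h2 : (2 : F) ≠ 0) (hF : 3 < Cardinal.mk F)
    (hid : ∀ x : A, ((x * x) * x) * (x * x) = x * ((x * x) * (x * x)))
    {u y : A} (hu : e * u = (2⁻¹ : F) • u) (hy : e * y = 0) :
    u * (y * y) = (2 : F) • ((u * y) * y) := by
  have h0 := linearized_quintic h2 hF hid y u
  have hp := linearized_quintic h2 hF hid (e + y) u
  have hm := linearized_quintic h2 hF hid (e - y) u
  have heU : ∀ a : A, e * a = (2⁻¹ : F) • a → a * e = (2⁻¹ : F) • a := fun a h => by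
    rw [mul_comm, h]
  have hye : y * e = 0 := by rw [mul_comm, hy]
  have hyy := he.fusionZZ y y hy hy
  have hyye : (y * y) * e = 0 := by rw [mul_comm, hyy]
  have huy := he.fusionUZ u y hu hy
  have huyy := he.fusionUZ _ y huy hy
  have hus := he.fusionUZ u _ hu hyy
  have c1 := mul_comm y u
  have c2 := mul_comm (y * y) u
  have c3 := mul_comm ((y * y) * y) u
  have c4 := mul_comm y (u * y)
  have c5 := mul_comm y (u * (y * y))
  have c6 := mul_comm ((y * y) * y) (u * y)
  have c7 := mul_comm (y * y) (u * y)
  simp only [mul_sub, sub_mul, mul_add, add_mul, smul_mul_assoc, mul_smul_comm, hu, hy, hye,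
    he.idem, hyy, hyye, huy, hus, heU _ hu, heU _ huy, heU _ huyy, heU _ hus, c1, c2, c3, c4, c5,
    c6, c7, smul_add, smul_sub, smul_smul, smul_zero, add_zero, zero_add, sub_zero, zero_sub,
    zero_mul, mul_zero, neg_mul, mul_neg, smul_neg] at h0 hp hm
  linear_combination (norm := (match_scalars <;> clear * - h2 <;> grind))
    hp + hm - (2 : F) • h0

/-- Polarization of `mul_sq`. -/
theorem mul_mul_derivation (he : IsHalfAxis F e) (h2 : (2 : F) ≠ 0) (hF : 3 < Cardinal.mk F)
    (hid : ∀ x : A, ((x * x) * x) * (x * x) = x * ((x * x) * (x * x)))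
    {u y z : A} (hu : e * u = (2⁻¹ : F) • u) (hy : e * y = 0) (hz : e * z = 0) :
    u * (y * z) = (u * y) * z + (u * z) * y := by
  have hs := mul_sq he h2 hF hid hu (y := y + z) (by rw [mul_add, hy, hz, add_zero])
  have hsy := mul_sq he h2 hF hid hu hy
  have hsz := mul_sq he h2 hF hid hu hz
  have c := mul_comm z y
  simp only [mul_add, add_mul, smul_add, c] at hs
  linear_combination (norm := (match_scalars <;> clear * - h2 <;> grind))
    (2⁻¹ : F) • hs - (2⁻¹ : F) • hsy - (2⁻¹ : F) • hsz

end IsHalfAxis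

theorem stmt15 {F : Type*} [Field F] {A : Type*} [NonUnitalNonAssocCommRing A]
    [Module F A] [SMulCommClass F A A] [IsScalarTower F A A]
    (h2 : (2 : F) ≠ 0) (hF : 3 < Cardinal.mk F)
    (hid1 : ∀ x : A, (x * x) * (x * x) = ((x * x) * x) * x)
    (hid2 : ∀ x : A, ((x * x) * x) * (x * x) = x * (((x * x) * x) * x))
    (e : A) (he : IsHalfAxis F e)
    (u₁ u₂ : A) (hu₁ : e * u₁ = (2⁻¹ : F) • u₁) (hu₂ : e * u₂ = (2⁻¹ : F) • u₂)
    (hsq : ¬ (e * (u₁ * u₁) = 0)) :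
    (u₁ * u₁) * (u₁ * u₂) = u₁ * ((u₁ * u₁) * u₂) := by
  obtain ⟨α, z, hz, huu⟩ := he.fusionUU u₁ u₁ hu₁ hu₁
  obtain ⟨β, w, hw, huv⟩ := he.fusionUU u₁ u₂ hu₁ hu₂
  have hu0 : u₁ ≠ 0 := by
    rintro rfl
    exact hsq (by simp)
  have hcube := he.cube_eq h2 hF hid1 hu₁ hz huu
  have hpol := he.cube_polarized h2 hF hid1 hu₁ hu₂ hz huu hw huv
  have huw := he.fusionUZ u₁ w hu₁ hw
  obtain ⟨γ, r, hr, hur⟩ := he.fusionUU u₁ (u₁ * w) hu₁ huw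
  have hr2 := he.mul_mul_zero_part h2 hF hid1 hu₁ hw hz huu hr hur
  have hpolw := he.cube_polarized h2 hF hid1 hu₁ huw hz huu hr hur
  have hder := he.mul_mul_derivation h2 hF (fun x => by rw [hid2, hid1]) hu₁ hz hw
  have hue : u₁ * e = (2⁻¹ : F) • u₁ := by rw [mul_comm, hu₁]
  have hsqmul : (2 : F) • ((u₁ * u₁) * (u₁ * u₂)) = α • (u₁ * u₂) + β • (u₁ * u₁) := by
    have hL := linearized_quartic h2 hF hid1 u₁ u₂
    have hpol' := congrArg (· * u₁) hpol
    have c1 := mul_comm (u₁ * u₂) u₁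
    have c2 := mul_comm u₂ u₁
    simp only [hcube, add_mul, smul_mul_assoc, c1, c2] at hL hpol'
    linear_combination (norm := (match_scalars <;> clear * - h2 <;> grind))
      (2⁻¹ : F) • hL + (2⁻¹ : F) • hpol'
  have hzw : (2 : F) • (z * w) = β • z + α • w := by
    have hze : z * e = 0 := by rw [mul_comm, hz]
    simp only [huu, huv, add_mul, mul_add, smul_mul_assoc, mul_smul_comm, he.idem, hw, hze,
      smul_add, smul_zero, add_zero, zero_add] at hsqmul
    linear_combination (norm := (match_scalars <;> clear * - h2 <;> grind))
      hsqmul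
  have huz : u₁ * z = (α / 2) • u₁ := by
    rw [huu, add_mul, smul_mul_assoc, hu₁, mul_comm z] at hcube
    linear_combination (norm := (match_scalars <;> clear * - h2 <;> grind))
      hcube
  have huzw : (2 : F) • (u₁ * (z * w)) = (β * α / 2) • u₁ + α • (u₁ * w) := by
    rw [← mul_smul_comm, hzw, mul_add, mul_smul_comm, mul_smul_comm, huz]
    module
  have hγ : γ = α * β / 2 := by
    have hur' : (2 : F) • (u₁ * r) = u₁ * (z * w) := by rw [← mul_smul_comm, hr2]
    rw [huu, hur, add_mul, smul_mul_assoc, huw, mul_add, mul_smul_comm, hue] at hpolw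
    rw [huz, smul_mul_assoc, mul_comm (u₁ * w) z] at hder
    have h0 : (γ - α * β / 2) • u₁ = 0 := by
      linear_combination (norm := (match_scalars <;> clear * - h2 <;> grind))
        hur' - hder + huzw - hpolw
    exact sub_eq_zero.mp ((smul_eq_zero.mp h0).resolve_right hu0)
  have hmul : u₁ * ((u₁ * u₁) * u₂) =
      α • (u₁ * u₂) + β • (u₁ * u₁) - (2 : F) • (u₁ * (u₁ * w)) := by
    have hp : (u₁ * u₁) * u₂ = α • u₂ + β • u₁ - (2 : F) • (u₁ * w) := by
      have h3 : u₁ * (u₁ * u₂) = (β / 2) • u₁ + u₁ * w := by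
        rw [huv, mul_add, mul_smul_comm, hue]
        module
      linear_combination (norm := (match_scalars <;> clear * - h2 <;> grind))
        hpol - (2 : F) • h3
    rw [hp, mul_sub, mul_add, mul_smul_comm, mul_smul_comm, mul_smul_comm]
  rw [hmul, hur, hγ, huv, huu]
  rw [huv, huu] at hsqmul
  linear_combination (norm := (match_scalars <;> clear * - h2 <;> grind))
    (2⁻¹ : F) • hsqmul + hr2 + (2⁻¹ : F) • hzw
end

section
/- Let e ∈ A be a half-axis, u ∈ U := A_{1/2}(e) and z ∈ Z := A_0(e). Then (u²z²)z = (u²z)z². -/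
/-- The component of `x³x² - x x⁴` that is linear in `y`, after replacing `x` by `x + y`. -/
def quinticDeriv {A : Type*} [NonUnitalNonAssocCommRing A] (x y : A) : A :=
  ((x * x) * x) * (x * y + x * y) + ((x * y + x * y) * x + (x * x) * y) * (x * x)
    - y * (((x * x) * x) * x)
    - x * (((x * y + x * y) * x + (x * x) * y) * x + ((x * x) * x) * y)

/-- The component of `x²x² = x⁴` of degree `(1, 1, 2)` in `(a, b, y)`. -/
theorem quartic_polarization {A : Type*} [NonUnitalNonAssocCommRing A]
    (htor : ∀ a : A, a + a = 0 → a = 0)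
    (hid : ∀ x : A, (x * x) * (x * x) = ((x * x) * x) * x) (a b y : A) :
    (4 : ℤ) • ((a * b) * (y * y)) + (8 : ℤ) • ((a * y) * (b * y)) =
      (2 : ℤ) • (((a * b) * y) * y) + (2 : ℤ) • (((a * y) * b) * y + ((b * y) * a) * y)
      + (2 : ℤ) • (((a * y) * y) * b + ((b * y) * y) * a)
      + ((y * y) * a) * b + ((y * y) * b) * a := by
  have key : ∀ x : A, (2 : ℤ) • ((x * x) * (y * y)) + (4 : ℤ) • ((x * y) * (x * y)) =
      ((x * x) * y) * y + (2 : ℤ) • (((x * y) * x) * y) + (2 : ℤ) • (((x * y) * y) * x)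
      + ((y * y) * x) * x := by
    intro x
    have h1 := hid (x + y)
    have h2 := hid (x - y)
    have h3 := hid x
    have h4 := hid y
    rw [← sub_eq_zero]
    apply htor
    simp only [mul_add, add_mul, mul_sub, mul_comm] at h1 h2 h3 h4 ⊢
    linear_combination (norm := module) h1 + h2 - (2 : ℤ) • h3 - (2 : ℤ) • h4
  have h1 := key (a + b)
  have h2 := key a
  have h3 := key b
  simp only [mul_add, add_mul, mul_comm] at h1 h2 h3 ⊢
  linear_combination (norm := module) h1 - h2 - h3

theorem quinticDeriv_parallelogram {A : Type*} [NonUnitalNonAssocCommRing A]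
    (htor : ∀ a : A, a + a = 0 → a = 0)
    (hid : ∀ x : A, ((x * x) * x) * (x * x) = x * (((x * x) * x) * x)) (a b y : A) :
    quinticDeriv (a + b) y + quinticDeriv (a - b) y =
      (2 : ℤ) • quinticDeriv a y + (2 : ℤ) • quinticDeriv b y := by
  have odd : ∀ x : A, quinticDeriv x y =
      x * (((y * y) * x + (x * y + x * y) * y) * y + ((y * y) * y) * x)
        + y * (((x * x) * y + (x * y + x * y) * x) * y
          + ((y * y) * x + (x * y + x * y) * y) * x)
        - (((x * x) * y + (x * y + x * y) * x) * (y * y)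
          + ((y * y) * x + (x * y + x * y) * y) * (x * y + x * y)
          + ((y * y) * y) * (x * x)) := by
    intro x
    have h1 := hid (x + y)
    have h2 := hid (x - y)
    have h4 := hid y
    rw [← sub_eq_zero]
    apply htor
    simp only [quinticDeriv, mul_add, add_mul, mul_sub, mul_comm]
      at h1 h2 h4 ⊢
    linear_combination (norm := module) h1 - h2 - (2 : ℤ) • h4
  rw [odd, odd, odd, odd]
  simp only [mul_add, add_mul, mul_sub, mul_comm]
  module

namespace IsHalfAxis

variable {F : Type*} [Field F] {A : Type*} [NonUnitalNonAssocCommRing A]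
  [Module F A] [SMulCommClass F A A] [IsScalarTower F A A] {e : A}

/-- `Z` acts on `U` through a Jordan homomorphism: `u z² = 2 (u z) z`. -/
theorem mul_sq_zero_part (h2 : (2 : F) ≠ 0)
    (hid1 : ∀ x : A, (x * x) * (x * x) = ((x * x) * x) * x)
    (hid2 : ∀ x : A, ((x * x) * x) * (x * x) = x * (((x * x) * x) * x))
    (he : IsHalfAxis F e) {u z : A} (hu : e * u = (2⁻¹ : F) • u) (hz : e * z = 0) :
    u * (z * z) = (2 : F) • ((u * z) * z) := by
  have htor : ∀ a : A, a + a = 0 → a = 0 := fun a ha => by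
    rw [← two_smul F] at ha
    exact (smul_eq_zero.1 ha).resolve_left h2
  have huz := he.fusionUZ u z hu hz
  have huzz := he.fusionUZ _ z huz hz
  have hzz := he.fusionZZ z z hz hz
  have huz2 := he.fusionUZ u _ hu hzz
  have hee := he.idem
  have hze : z * e = 0 := by rw [mul_comm, hz]
  have three : (3 : F) • (u * (z * z) - (2 : F) • ((u * z) * z)) = 0 := by
    have h := quartic_polarization htor hid1 e u z
    have c1 : (z * z) * e = 0 := by rw [mul_comm, hzz]
    have c2 : z * z * u * e = (2⁻¹ : F) • (u * (z * z)) := by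
      rw [mul_comm, mul_comm (z * z), huz2]
    have c3 : u * z * e = (2⁻¹ : F) • (u * z) := by rw [mul_comm, huz]
    have c4 : u * z * z * e = (2⁻¹ : F) • (u * z * z) := by rw [mul_comm, huzz]
    simp only [hu, hz, c1, c2, c3, c4, smul_mul_assoc, zero_mul] at h
    rw [← sub_eq_zero] at h
    have := congrArg (fun a => (2 : F) • a) h
    simp only [smul_zero] at this
    rw [← this]
    match_scalars <;> field_simp <;> ring
  have five : (5 : F) • (u * (z * z) - (2 : F) • ((u * z) * z)) = 0 := by
    have h := quinticDeriv_parallelogram htor hid2 e z u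
    have hZe : ∀ y : A, e * y = 0 → y * e = 0 := fun y hy => by rw [mul_comm, hy]
    have hUe : ∀ v : A, e * v = (2⁻¹ : F) • v → v * e = (2⁻¹ : F) • v := fun v hv => by
      rw [mul_comm, hv]
    have hUZ := he.fusionUZ
    have hZU : ∀ y v : A, e * v = (2⁻¹ : F) • v → e * y = 0 →
        e * (y * v) = (2⁻¹ : F) • (y * v) := fun y v hv hy => by
      rw [mul_comm y, hUZ v y hv hy]
    have hUZe := fun v y hv hy => hUe _ (hUZ v y hv hy)
    have hZUe := fun y v hv hy => hUe _ (hZU y v hv hy)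
    have hZZe := fun y y' hy hy' => hZe _ (he.fusionZZ y y' hy hy')
    simp only [quinticDeriv, mul_add, add_mul, mul_sub, sub_mul, mul_smul_comm, smul_mul_assoc,
      hee, hu, hUe u hu, hz, hze, hUZ, hZU, he.fusionZZ, hUZe, hZUe, hZZe, mul_zero, zero_mul,
      add_zero, zero_add, sub_zero, zero_sub, mul_neg, neg_mul] at h
    simp only [mul_comm] at h ⊢
    rw [← sub_eq_zero] at h
    have := congrArg (fun a => (2 : F) • a) h
    simp only [smul_zero] at this
    rw [← this]
    match_scalars <;> field_simp <;> ring
  have hc := congrArg₂ (fun a b => (2 : F) • a - b) three five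
  simp only [smul_zero, sub_zero] at hc
  rw [← sub_eq_zero, ← hc]
  module

/-- `u² z ≡ 2 u (u z)` modulo `F e`. -/
theorem sq_mul (h2 : (2 : F) ≠ 0)
    (hid1 : ∀ x : A, (x * x) * (x * x) = ((x * x) * x) * x)
    (he : IsHalfAxis F e) {u z : A} (hu : e * u = (2⁻¹ : F) • u) (hz : e * z = 0) :
    ∃ c : F, (u * u) * z = (2 : F) • (u * (u * z)) + c • e := by
  have htor : ∀ a : A, a + a = 0 → a = 0 := fun a ha => by
    rw [← two_smul F] at ha
    exact (smul_eq_zero.1 ha).resolve_left h2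
  have huz := he.fusionUZ u z hu hz
  obtain ⟨c, w, hw, hc⟩ := he.fusionUU u u hu hu
  obtain ⟨d, v, hv, hd⟩ := he.fusionUU u _ hu huz
  have hwz := he.fusionZZ w z hw hz
  have h := quartic_polarization htor hid1 e z u
  have c1 : u * u * z = w * z := by rw [hc, add_mul, smul_mul_assoc, hz]; simp
  have c2 : (u * u * e) * z = 0 := by
    rw [mul_comm _ e, hc, mul_add, hw, mul_smul_comm, he.idem, add_zero, smul_mul_assoc, hz,
      smul_zero]
  have c3 : u * u * z * e = 0 := by rw [c1, mul_comm, hwz]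
  have c4 : z * u * e = (2⁻¹ : F) • (u * z) := by rw [mul_comm, mul_comm z, huz]
  have c5 : z * u * u * e = d • e := by
    rw [mul_comm, mul_comm (z * u), mul_comm z, hd, mul_add, hv, mul_smul_comm, he.idem, add_zero]
  refine ⟨-(2 * d), ?_⟩
  simp only [hu, hz, c2, c3, c4, c5, smul_mul_assoc, zero_mul] at h
  rw [mul_comm z u, mul_comm (u * z) u] at h
  apply sub_eq_zero.1
  rw [← sub_eq_zero] at h
  rw [← neg_zero, ← h]
  match_scalars <;> field_simp <;> ring

/-- `(u v) z ≡ u (v z) + v (u z)` modulo `F e`. -/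
theorem polar_mul (h2 : (2 : F) ≠ 0)
    (hid1 : ∀ x : A, (x * x) * (x * x) = ((x * x) * x) * x)
    (he : IsHalfAxis F e) {u v z : A} (hu : e * u = (2⁻¹ : F) • u) (hv : e * v = (2⁻¹ : F) • v)
    (hz : e * z = 0) :
    ∃ c : F, (u * v) * z = u * (v * z) + v * (u * z) + c • e := by
  obtain ⟨a, ha⟩ := he.sq_mul h2 hid1 hu hz
  obtain ⟨b, hb⟩ := he.sq_mul h2 hid1 hv hz
  obtain ⟨c, hc⟩ := he.sq_mul h2 hid1
    (show e * (u + v) = (2⁻¹ : F) • (u + v) by rw [mul_add, hu, hv, smul_add]) hz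
  refine ⟨2⁻¹ * (c - a - b), ?_⟩
  simp only [add_mul, mul_add, mul_comm v u] at hc
  apply (smul_right_injective A h2)
  simp only [smul_add, smul_smul, mul_inv_cancel_left₀ h2]
  linear_combination (norm := module) hc - ha - hb

end IsHalfAxis

theorem stmt16 {F : Type*} [Field F] {A : Type*} [NonUnitalNonAssocCommRing A]
    [Module F A] [SMulCommClass F A A] [IsScalarTower F A A]
    (h2 : (2 : F) ≠ 0) (hF : 3 < Cardinal.mk F)
    (hid1 : ∀ x : A, (x * x) * (x * x) = ((x * x) * x) * x)
    (hid2 : ∀ x : A, ((x * x) * x) * (x * x) = x * (((x * x) * x) * x))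
    (e : A) (he : IsHalfAxis F e)
    (u z : A) (hu : e * u = (2⁻¹ : F) • u) (hz : e * z = 0) :
    ((u * u) * (z * z)) * z = ((u * u) * z) * (z * z) := by
  have huz := he.fusionUZ u z hu hz
  have hzz := he.fusionZZ z z hz hz
  have hjordan := he.mul_sq_zero_part h2 hid1 hid2 hu hz
  have hjordan' := he.mul_sq_zero_part h2 hid1 hid2 huz hz
  obtain ⟨a, ha⟩ := he.sq_mul h2 hid1 hu hzz
  obtain ⟨b, hb⟩ := he.sq_mul h2 hid1 hu hz
  obtain ⟨c, hc⟩ := he.polar_mul h2 hid1 hu (he.fusionUZ u _ hu hzz) hz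
  obtain ⟨d, hd⟩ := he.polar_mul h2 hid1 hu huz hzz
  have hdiff : ((u * u) * (z * z)) * z - ((u * u) * z) * (z * z) = ((2 : F) * (c - d)) • e := by
    rw [ha, hb, add_mul, add_mul, smul_mul_assoc, smul_mul_assoc, smul_mul_assoc, smul_mul_assoc,
      hc, hd, hz, hzz, hjordan', hjordan]
    simp only [mul_smul_comm, smul_mul_assoc, mul_comm (u * z * z) (u * z)]
    module
  obtain ⟨r, w, hw, hr⟩ := he.fusionUU u u hu hu
  have hw' : ∀ y : A, e * y = 0 → (u * u) * y = w * y := fun y hy => by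
    rw [hr, add_mul, smul_mul_assoc, hy, smul_zero, zero_add]
  have hzero : e * (((u * u) * (z * z)) * z - ((u * u) * z) * (z * z)) = 0 := by
    rw [hw' z hz, hw' _ hzz, mul_sub,
      he.fusionZZ _ _ (he.fusionZZ w _ hw hzz) hz, he.fusionZZ _ _ (he.fusionZZ w z hw hz) hzz,
      sub_zero]
  rw [hdiff, mul_smul_comm, he.idem, ← hdiff] at hzero
  exact sub_eq_zero.1 hzero
end

section
/- Let e ∈ A be a half-axis, write U := A_{1/2}(e), Z := A_0(e), and assume condition (*): φ_e(u₁(u₂z)) = φ_e(u₂(u₁z)) for all u₁, u₂ ∈ U and z ∈ Z. Then A is a Jordan algebra if and only if Z is a Jordan algebra, i.e., if and only if z₁(z₁²z₂) = z₁²(z₁z₂) for all z₁, z₂ ∈ Z. -/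
/-- Linear projections `φ` (coefficient of `e`) and `π` (component in `A_0(e)`) for the Peirce
decomposition of a commutative algebra with respect to `e`. -/
structure PeirceProj (F : Type*) [Field F] {A : Type*} [NonUnitalNonAssocCommRing A]
    [Module F A] [SMulCommClass F A A] [IsScalarTower F A A] (e : A)
    (φ : A →ₗ[F] F) (π : A →ₗ[F] A) : Prop where
  idem : e * e = e
  phi_e : φ e = 1
  phi_half : ∀ u, e * u = (2⁻¹ : F) • u → φ u = 0
  phi_zero : ∀ z, e * z = 0 → φ z = 0
  pi_e : π e = 0
  pi_half : ∀ u, e * u = (2⁻¹ : F) • u → π u = 0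
  pi_zero : ∀ z, e * z = 0 → π z = z
  mul_pi : ∀ x, e * π x = 0
  zero_mul_zero : ∀ z z' : A, e * z = 0 → e * z' = 0 → e * (z * z') = 0
  half_mul_half : ∀ u u' : A, e * u = (2⁻¹ : F) • u → e * u' = (2⁻¹ : F) • u' →
      u * u' = φ (u * u') • e + π (u * u')
  half_mul_zero : ∀ u z : A, e * u = (2⁻¹ : F) • u → e * z = 0 →
      e * (u * z) = (2⁻¹ : F) • (u * z)

namespace PeirceProj

theorem half_add {F : Type*} [Field F] {A : Type*} [NonUnitalNonAssocCommRing A]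
    [Module F A] {e u v : A} (hu : e * u = (2⁻¹ : F) • u) (hv : e * v = (2⁻¹ : F) • v) :
    e * (u + v) = (2⁻¹ : F) • (u + v) := by
  rw [mul_add, hu, hv, smul_add]

theorem half_sub {F : Type*} [Field F] {A : Type*} [NonUnitalNonAssocCommRing A]
    [Module F A] {e u v : A} (hu : e * u = (2⁻¹ : F) • u) (hv : e * v = (2⁻¹ : F) • v) :
    e * (u - v) = (2⁻¹ : F) • (u - v) := by
  rw [mul_sub, hu, hv, smul_sub]

end PeirceProj

section

variable {F : Type*} [Field F] {A : Type*} [NonUnitalNonAssocCommRing A]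
    [Module F A] [SMulCommClass F A A] [IsScalarTower F A A] {e : A}

theorem IsHalfAxis.exists_peirceProj (h2 : (2 : F) ≠ 0) (he : IsHalfAxis F e) :
    ∃ (φ : A →ₗ[F] F) (π : A →ₗ[F] A), PeirceProj F e φ π := by
  have e0 : e ≠ 0 := by
    rintro rfl
    have := he.indep 1 0 0 (by simp) (by simp) (by simp)
    exact one_ne_zero this.1
  obtain ⟨f, hf⟩ := Module.Projective.exists_dual_eq_one F e0
  let L : A →ₗ[F] A := LinearMap.mulLeft F e
  let φ : A →ₗ[F] F := f ∘ₗ ((2 : F) • (L ∘ₗ L) - L)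
  let π : A →ₗ[F] A := LinearMap.id - (3 : F) • L + (2 : F) • (L ∘ₗ L)
  have hφ : ∀ x, φ x = f ((2 : F) • (e * (e * x)) - e * x) := fun x => rfl
  have hπ : ∀ x, π x = x - (3 : F) • (e * x) + (2 : F) • (e * (e * x)) := fun x => rfl
  have phi_e : φ e = 1 := by
    rw [hφ, he.idem, he.idem, ← hf]; congr 1; module
  have phi_half : ∀ u, e * u = (2⁻¹ : F) • u → φ u = 0 := fun u hu => by
    rw [hφ, hu, mul_smul_comm, hu, ← map_zero f]; congr 1
    match_scalars; field_simp; ring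
  have phi_zero : ∀ z, e * z = 0 → φ z = 0 := fun z hz => by
    simp [hφ, hz]
  have pi_e : π e = 0 := by
    rw [hπ, he.idem, he.idem]; module
  have pi_half : ∀ u, e * u = (2⁻¹ : F) • u → π u = 0 := fun u hu => by
    rw [hπ, hu, mul_smul_comm, hu]
    match_scalars; field_simp; ring
  have pi_zero : ∀ z, e * z = 0 → π z = z := fun z hz => by
    simp [hπ, hz]
  refine ⟨φ, π, he.idem, phi_e, phi_half, phi_zero, pi_e, pi_half, pi_zero, fun x => ?_,
    he.fusionZZ, fun u v hu hv => ?_, he.fusionUZ⟩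
  · obtain ⟨c, u, z, hu, hz, rfl⟩ := he.decomp x
    rw [map_add, map_add, map_smul, pi_e, pi_half u hu, pi_zero z hz]
    simpa using hz
  · obtain ⟨c, z, hz, h⟩ := he.fusionUU u v hu hv
    rw [h, map_add, map_add, map_smul, map_smul, pi_e, phi_e, phi_zero z hz, pi_zero z hz]
    simp

namespace PeirceProj

variable {φ : A →ₗ[F] F} {π : A →ₗ[F] A}

theorem mul_eq (H : PeirceProj F e φ π)
    {u v z w : A} (c d : F) (hu : e * u = (2⁻¹ : F) • u) (hz : e * z = 0)
    (hv : e * v = (2⁻¹ : F) • v) (hw : e * w = 0) :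
    (c • e + u + z) * (d • e + v + w) = (c * d + φ (u * v)) • e +
      ((2⁻¹ * c) • v + (2⁻¹ * d) • u + u * w + v * z) + (π (u * v) + z * w) := by
  have h := H.half_mul_half u v hu hv
  have h3 : u * e = (2⁻¹ : F) • u := by rw [mul_comm, hu]
  have h4 : z * e = 0 := by rw [mul_comm, hz]
  simp only [mul_add, add_mul, smul_mul_assoc, mul_smul_comm, H.idem, hv, hw, h3, h4]
  rw [mul_comm z v]
  linear_combination (norm := module) h

theorem half_part (H : PeirceProj F e φ π)
    {u v z w : A} (c d : F) (hu : e * u = (2⁻¹ : F) • u) (hz : e * z = 0)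
    (hv : e * v = (2⁻¹ : F) • v) (hw : e * w = 0) :
    e * (c • v + d • u + u * w + v * z) = (2⁻¹ : F) • (c • v + d • u + u * w + v * z) := by
  simp only [mul_add, mul_smul_comm, hu, hv, H.half_mul_zero u w hu hw, H.half_mul_zero v z hv hz]
  module

theorem zero_part (H : PeirceProj F e φ π)
    {x z w : A} (hz : e * z = 0) (hw : e * w = 0) : e * (π x + z * w) = 0 := by
  rw [mul_add, H.mul_pi, H.zero_mul_zero z w hz hw, add_zero]

theorem components_eq (H : PeirceProj F e φ π)
    {u v z w : A} {c d : F} (hu : e * u = (2⁻¹ : F) • u) (hz : e * z = 0)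
    (hv : e * v = (2⁻¹ : F) • v) (hw : e * w = 0) (h : c • e + u + z = d • e + v + w) :
    c = d ∧ u = v ∧ z = w := by
  have hc := congrArg φ h
  have hp := congrArg π h
  simp only [map_add, map_smul, H.phi_e, H.phi_half u hu, H.phi_half v hv, H.phi_zero z hz,
    H.phi_zero w hw, H.pi_e, H.pi_half u hu, H.pi_half v hv, H.pi_zero z hz, H.pi_zero w hw,
    smul_eq_mul, mul_one, add_zero, smul_zero, zero_add] at hc hp
  subst hc hp
  simpa using h

theorem pow_four_components (H : PeirceProj F e φ π) (hid1 : ∀ x : A, (x * x) * (x * x) = ((x * x) * x) * x)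
    {u z : A} (hu : e * u = (2⁻¹ : F) • u) (hz : e * z = 0) (t : F) {c₂ c₃ : F} {u₂ u₃ z₂ z₃ : A}
    (hc₂ : c₂ = t * t + φ (u * u))
    (hu₂ : u₂ = (2⁻¹ * t) • u + (2⁻¹ * t) • u + u * z + u * z)
    (hz₂ : z₂ = π (u * u) + z * z)
    (hc₃ : c₃ = c₂ * t + φ (u₂ * u))
    (hu₃ : u₃ = (2⁻¹ * c₂) • u + (2⁻¹ * t) • u₂ + u₂ * z + u * z₂)
    (hz₃ : z₃ = π (u₂ * u) + z₂ * z) :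
    (2⁻¹ * c₂) • u₂ + (2⁻¹ * c₂) • u₂ + u₂ * z₂ + u₂ * z₂ =
        (2⁻¹ * c₃) • u + (2⁻¹ * t) • u₃ + u₃ * z + u * z₃ ∧
      π (u₂ * u₂) + z₂ * z₂ = π (u₃ * u) + z₃ * z := by
  have ha : e * u₂ = (2⁻¹ : F) • u₂ := hu₂ ▸ H.half_part _ _ hu hz hu hz
  have hb : e * z₂ = 0 := hz₂ ▸ H.zero_part hz hz
  have ha' : e * u₃ = (2⁻¹ : F) • u₃ := hu₃ ▸ H.half_part _ _ ha hb hu hz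
  have hb' : e * z₃ = 0 := hz₃ ▸ H.zero_part hb hz
  have h := hid1 (t • e + u + z)
  rw [H.mul_eq t t hu hz hu hz, ← hc₂, ← hu₂, ← hz₂, H.mul_eq _ _ ha hb ha hb,
    H.mul_eq _ _ ha hb hu hz, ← hc₃, ← hu₃, ← hz₃, H.mul_eq _ _ ha' hb' hu hz] at h
  exact (H.components_eq (H.half_part _ _ ha hb ha hb) (H.zero_part hb hb)
    (H.half_part _ _ ha' hb' hu hz) (H.zero_part hb' hz) h).2

theorem pow_five_half (H : PeirceProj F e φ π)
    (hid2 : ∀ x : A, ((x * x) * x) * (x * x) = x * (((x * x) * x) * x))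
    {u z : A} (hu : e * u = (2⁻¹ : F) • u) (hz : e * z = 0) (t : F) {c₂ c₃ c₄ : F}
    {u₂ u₃ u₄ z₂ z₃ z₄ : A}
    (hc₂ : c₂ = t * t + φ (u * u))
    (hu₂ : u₂ = (2⁻¹ * t) • u + (2⁻¹ * t) • u + u * z + u * z)
    (hz₂ : z₂ = π (u * u) + z * z)
    (hc₃ : c₃ = c₂ * t + φ (u₂ * u))
    (hu₃ : u₃ = (2⁻¹ * c₂) • u + (2⁻¹ * t) • u₂ + u₂ * z + u * z₂)
    (hz₃ : z₃ = π (u₂ * u) + z₂ * z)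
    (hc₄ : c₄ = c₃ * t + φ (u₃ * u))
    (hu₄ : u₄ = (2⁻¹ * c₃) • u + (2⁻¹ * t) • u₃ + u₃ * z + u * z₃)
    (hz₄ : z₄ = π (u₃ * u) + z₃ * z) :
    (2⁻¹ * c₃) • u₂ + (2⁻¹ * c₂) • u₃ + u₃ * z₂ + u₂ * z₃ =
      (2⁻¹ * t) • u₄ + (2⁻¹ * c₄) • u + u * z₄ + u₄ * z := by
  have ha : e * u₂ = (2⁻¹ : F) • u₂ := hu₂ ▸ H.half_part _ _ hu hz hu hz
  have hb : e * z₂ = 0 := hz₂ ▸ H.zero_part hz hz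
  have ha' : e * u₃ = (2⁻¹ : F) • u₃ := hu₃ ▸ H.half_part _ _ ha hb hu hz
  have hb' : e * z₃ = 0 := hz₃ ▸ H.zero_part hb hz
  have ha'' : e * u₄ = (2⁻¹ : F) • u₄ := hu₄ ▸ H.half_part _ _ ha' hb' hu hz
  have hb'' : e * z₄ = 0 := hz₄ ▸ H.zero_part hb' hz
  have h := hid2 (t • e + u + z)
  rw [H.mul_eq t t hu hz hu hz, ← hc₂, ← hu₂, ← hz₂, H.mul_eq _ _ ha hb hu hz, ← hc₃, ← hu₃,
    ← hz₃, H.mul_eq _ _ ha' hb' hu hz, ← hc₄, ← hu₄, ← hz₄, H.mul_eq _ _ ha' hb' ha hb,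
    H.mul_eq _ _ hu hz ha'' hb''] at h
  exact (H.components_eq (H.half_part _ _ ha' hb' ha hb) (H.zero_part hb' hb)
    (H.half_part _ _ hu hz ha'' hb'') (H.zero_part hz hb'') h).2.1

theorem half_cube (H : PeirceProj F e φ π)
    (h2 : (2 : F) ≠ 0) (hid1 : ∀ x : A, (x * x) * (x * x) = ((x * x) * x) * x)
    {u : A} (hu : e * u = (2⁻¹ : F) • u) : u * π (u * u) = (2⁻¹ * φ (u * u)) • u := by
  have h := (H.pow_four_components hid1 hu (mul_zero e) 1 rfl rfl rfl rfl rfl rfl).1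
  simp only [mul_add, add_mul, mul_smul_comm, smul_mul_assoc, map_add, map_smul, smul_add,
    add_smul, smul_smul, smul_eq_mul, mul_zero, add_zero] at h
  linear_combination (norm := (match_scalars <;> field_simp <;> ring)) (2 : F) • h

theorem two_smul_pi_mul_half (H : PeirceProj F e φ π) (h2 : (2 : F) ≠ 0)
    (hid1 : ∀ x : A, (x * x) * (x * x) = ((x * x) * x) * x)
    {u z : A} (hu : e * u = (2⁻¹ : F) • u) (hz : e * z = 0) :
    z * π (u * u) = (2 : F) • π (u * (u * z)) := by
  have h := (H.pow_four_components hid1 hu hz 1 rfl rfl rfl rfl rfl rfl).2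
  have h' := (H.pow_four_components hid1 hu hz 0 rfl rfl rfl rfl rfl rfl).2
  simp only [mul_add, add_mul, mul_smul_comm, smul_mul_assoc, map_add, map_smul, smul_add,
    add_smul, smul_smul, mul_zero, zero_smul, add_zero, zero_add] at h h'
  simp only [mul_comm (_ : A) (_ : A)] at h h' ⊢
  linear_combination (norm := (match_scalars <;> field_simp <;> ring)) h' - h

theorem half_mul_sq (H : PeirceProj F e φ π) (h2 : (2 : F) ≠ 0)
    (hid1 : ∀ x : A, (x * x) * (x * x) = ((x * x) * x) * x)
    (hid2 : ∀ x : A, ((x * x) * x) * (x * x) = x * (((x * x) * x) * x))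
    {u z : A} (hu : e * u = (2⁻¹ : F) • u) (hz : e * z = 0) :
    u * (z * z) = (2 : F) • (z * (u * z)) := by
  have hc := H.half_cube h2 hid1 hu
  have h3 : (3 : F) • (u * (z * z)) = (6 : F) • (z * (u * z)) := by
    have h := (H.pow_four_components hid1 hu hz 1 rfl rfl rfl rfl rfl rfl).1
    have h' := (H.pow_four_components hid1 hu hz 0 rfl rfl rfl rfl rfl rfl).1
    simp only [mul_add, add_mul, mul_smul_comm, smul_mul_assoc, map_add, map_smul, smul_add,
      add_smul, smul_smul, smul_eq_mul, mul_zero, zero_smul, add_zero, zero_add] at h h'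
    simp only [mul_comm (_ : A) (_ : A)] at h h' hc ⊢
    linear_combination (norm := (match_scalars <;> field_simp <;> ring))
      (2 : F) • h - (2 : F) • h' - hc
  have h5 : (5 : F) • (u * (z * z)) = (10 : F) • (z * (u * z)) := by
    have h := H.pow_five_half hid2 hu hz 1 rfl rfl rfl rfl rfl rfl rfl rfl rfl
    have h' := H.pow_five_half hid2 hu hz (-1) rfl rfl rfl rfl rfl rfl rfl rfl rfl
    have h'' := H.pow_five_half hid2 hu hz 0 rfl rfl rfl rfl rfl rfl rfl rfl rfl
    simp only [mul_add, add_mul, mul_smul_comm, smul_mul_assoc, map_add, map_smul, smul_add,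
      add_smul, smul_smul, smul_eq_mul, mul_zero, zero_smul, add_zero, zero_add] at h h' h''
    simp only [mul_comm (_ : A) (_ : A)] at h h' h'' hc ⊢
    linear_combination (norm := (match_scalars <;> field_simp <;> ring_nf))
      (2 : F) • h + (2 : F) • h' - (4 : F) • h'' - (3 : F) • hc
  linear_combination (norm := module) (2 : F) • h3 - h5

theorem half_cube_polar (H : PeirceProj F e φ π) (h2 : (2 : F) ≠ 0)
    (hid1 : ∀ x : A, (x * x) * (x * x) = ((x * x) * x) * x)
    {u v : A} (hu : e * u = (2⁻¹ : F) • u) (hv : e * v = (2⁻¹ : F) • v) :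
    (2 : F) • (u * π (u * v)) + v * π (u * u) =
      φ (u * v) • u + (2⁻¹ * φ (u * u)) • v := by
  have h := H.half_cube h2 hid1 (half_add hu hv)
  have h' := H.half_cube h2 hid1 (half_sub hu hv)
  have hc := H.half_cube h2 hid1 hv
  simp only [mul_add, add_mul, mul_sub, sub_mul, map_add, map_sub, smul_add, smul_sub, sub_smul,
    add_smul] at h h'
  simp only [mul_comm (_ : A) (_ : A)] at h h' hc ⊢
  linear_combination (norm := (match_scalars <;> field_simp <;> ring))
    (2⁻¹ : F) • h - (2⁻¹ : F) • h' - hc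

theorem half_cube_polar₃ (H : PeirceProj F e φ π) (h2 : (2 : F) ≠ 0)
    (hid1 : ∀ x : A, (x * x) * (x * x) = ((x * x) * x) * x)
    {u v w : A} (hu : e * u = (2⁻¹ : F) • u) (hv : e * v = (2⁻¹ : F) • v)
    (hw : e * w = (2⁻¹ : F) • w) :
    u * π (v * w) + v * π (u * w) + w * π (u * v) =
      (2⁻¹ : F) • (φ (v * w) • u + φ (u * w) • v + φ (u * v) • w) := by
  have h := H.half_cube_polar h2 hid1 (half_add hu hv) hw
  have hu' := H.half_cube_polar h2 hid1 hu hw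
  have hv' := H.half_cube_polar h2 hid1 hv hw
  simp only [mul_add, add_mul, map_add, smul_add, add_smul, smul_smul] at h hu' hv' ⊢
  simp only [mul_comm (_ : A) (_ : A)] at h hu' hv' ⊢
  linear_combination (norm := (match_scalars <;> field_simp <;> ring))
    (2⁻¹ : F) • h - (2⁻¹ : F) • hu' - (2⁻¹ : F) • hv'

theorem pi_mul_half (H : PeirceProj F e φ π) (h2 : (2 : F) ≠ 0)
    (hid1 : ∀ x : A, (x * x) * (x * x) = ((x * x) * x) * x)
    {u v z : A} (hu : e * u = (2⁻¹ : F) • u) (hv : e * v = (2⁻¹ : F) • v) (hz : e * z = 0) :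
    z * π (u * v) = π (u * (v * z)) + π (v * (u * z)) := by
  have h := H.two_smul_pi_mul_half h2 hid1 (half_add hu hv) hz
  have hu' := H.two_smul_pi_mul_half h2 hid1 hu hz
  have hv' := H.two_smul_pi_mul_half h2 hid1 hv hz
  simp only [mul_add, add_mul, map_add, smul_add] at h
  simp only [mul_comm (_ : A) (_ : A)] at h hu' hv' ⊢
  linear_combination (norm := (match_scalars <;> field_simp <;> ring))
    (2⁻¹ : F) • h - (2⁻¹ : F) • hu' - (2⁻¹ : F) • hv'

theorem half_mul_mul (H : PeirceProj F e φ π) (h2 : (2 : F) ≠ 0)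
    (hid1 : ∀ x : A, (x * x) * (x * x) = ((x * x) * x) * x)
    (hid2 : ∀ x : A, ((x * x) * x) * (x * x) = x * (((x * x) * x) * x))
    {u z w : A} (hu : e * u = (2⁻¹ : F) • u) (hz : e * z = 0) (hw : e * w = 0) :
    u * (z * w) = z * (u * w) + w * (u * z) := by
  have h := H.half_mul_sq h2 hid1 hid2 hu (z := z + w) (by rw [mul_add, hz, hw, add_zero])
  have hz' := H.half_mul_sq h2 hid1 hid2 hu hz
  have hw' := H.half_mul_sq h2 hid1 hid2 hu hw
  simp only [mul_add, add_mul, smul_add] at h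
  simp only [mul_comm (_ : A) (_ : A)] at h hz' hw' ⊢
  linear_combination (norm := (match_scalars <;> field_simp <;> ring))
    (2⁻¹ : F) • h - (2⁻¹ : F) • hz' - (2⁻¹ : F) • hw'

theorem pi_sq_mul (H : PeirceProj F e φ π) (h2 : (2 : F) ≠ 0)
    (hid1 : ∀ x : A, (x * x) * (x * x) = ((x * x) * x) * x)
    (hid2 : ∀ x : A, ((x * x) * x) * (x * x) = x * (((x * x) * x) * x))
    {u z : A} (hu : e * u = (2⁻¹ : F) • u) (hz : e * z = 0) :
    (2 : F) • (π (u * u) * (u * z)) = φ (u * (u * z)) • u := by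
  have h1 := congrArg (z * ·) (H.half_cube h2 hid1 hu)
  have h3 := H.half_mul_mul h2 hid1 hid2 hu (H.mul_pi (u * u)) hz
  have h4 := congrArg (u * ·) (H.two_smul_pi_mul_half h2 hid1 hu hz)
  have h5 := H.half_cube_polar h2 hid1 hu (H.half_mul_zero u z hu hz)
  simp only [mul_smul_comm] at h1 h4
  simp only [mul_comm (_ : A) (_ : A)] at h1 h3 h4 h5 ⊢
  linear_combination (norm := (match_scalars <;> field_simp <;> ring)) h5 + h4 - h3 - h1

theorem pi_mul_polar (H : PeirceProj F e φ π) (h2 : (2 : F) ≠ 0)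
    (hid1 : ∀ x : A, (x * x) * (x * x) = ((x * x) * x) * x)
    (hid2 : ∀ x : A, ((x * x) * x) * (x * x) = x * (((x * x) * x) * x))
    (hs : ∀ u v z : A, e * u = (2⁻¹ : F) • u → e * v = (2⁻¹ : F) • v → e * z = 0 →
      φ (u * (v * z)) = φ (v * (u * z)))
    {u v z : A} (hu : e * u = (2⁻¹ : F) • u) (hv : e * v = (2⁻¹ : F) • v) (hz : e * z = 0) :
    π (u * u) * (v * z) + (2 : F) • (π (u * v) * (u * z)) =
      φ (v * (u * z)) • u + (2⁻¹ * φ (u * (u * z))) • v := by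
  have h1 := congrArg (z * ·) (H.half_cube_polar h2 hid1 hu hv)
  have h3 := H.half_mul_mul h2 hid1 hid2 hv (H.mul_pi (u * u)) hz
  have h4 := congrArg (v * ·) (H.two_smul_pi_mul_half h2 hid1 hu hz)
  have h5 := H.half_mul_mul h2 hid1 hid2 hu (H.mul_pi (u * v)) hz
  have h6 := congrArg (u * ·) (H.pi_mul_half h2 hid1 hu hv hz)
  have h7 := H.half_cube_polar₃ h2 hid1 hu hv (H.half_mul_zero u z hu hz)
  have h8 := H.half_cube_polar h2 hid1 hu (H.half_mul_zero v z hv hz)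
  rw [hs u v z hu hv hz] at h8
  simp only [mul_smul_comm, mul_add] at h1 h4 h6
  simp only [mul_comm (_ : A) (_ : A)] at h1 h3 h4 h5 h6 h7 h8 ⊢
  linear_combination (norm := (match_scalars <;> field_simp <;> ring))
    (2⁻¹ : F) • h8 + h7 + h6 - h5 + (2⁻¹ : F) • h4 - (2⁻¹ : F) • h3 - (2⁻¹ : F) • h1

theorem jordan (H : PeirceProj F e φ π) (h2 : (2 : F) ≠ 0)
    (hid1 : ∀ x : A, (x * x) * (x * x) = ((x * x) * x) * x)
    (hid2 : ∀ x : A, ((x * x) * x) * (x * x) = x * (((x * x) * x) * x))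
    (hs : ∀ u v z : A, e * u = (2⁻¹ : F) • u → e * v = (2⁻¹ : F) • v → e * z = 0 →
      φ (u * (v * z)) = φ (v * (u * z)))
    (hZ : ∀ z w : A, e * z = 0 → e * w = 0 → z * ((z * z) * w) = (z * z) * (z * w))
    {u v z w : A} (t s : F) (hu : e * u = (2⁻¹ : F) • u) (hv : e * v = (2⁻¹ : F) • v)
    (hz : e * z = 0) (hw : e * w = 0) :
    ((t • e + u + z) * (s • e + v + w)) * ((t • e + u + z) * (t • e + u + z)) =
      (t • e + u + z) * ((s • e + v + w) * ((t • e + u + z) * (t • e + u + z))) := by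
  have hp := H.mul_pi (u * u)
  have huz := H.half_mul_zero u z hu hz
  have hvz := H.half_mul_zero v z hv hz
  have huw := H.half_mul_zero u w hu hw
  have hzz := H.zero_mul_zero z z hz hz
  have hu₂ := H.half_part (2⁻¹ * t) (2⁻¹ * t) hu hz hu hz
  have hz₂ := H.zero_part (x := u * u) hz hz
  rw [H.mul_eq t t hu hz hu hz, H.mul_eq t s hu hz hv hw,
    H.mul_eq s _ hv hw hu₂ hz₂,
    H.mul_eq _ _ (H.half_part _ _ hu hz hv hw) (H.zero_part hz hw) hu₂ hz₂,
    H.mul_eq t _ hu hz (H.half_part _ _ hv hw hu₂ hz₂) (H.zero_part hw hz₂)]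
  congr 1
  · congr 1
    · congr 1
      have a1 := hs u v z hu hv hz
      have a2 := hs u (v * z) z hu hvz hz
      have a3 := hs u (u * z) w hu huz hw
      have a4 := hs u v (π (u * u)) hu hv hp
      have a5 := congrArg (fun x => φ (u * x)) (H.half_mul_sq h2 hid1 hid2 hv hz)
      have a6 := congrArg (fun x => φ (v * x)) (H.half_cube h2 hid1 hu)
      simp only [mul_add, add_mul, mul_smul_comm, smul_mul_assoc, map_add, map_smul,
        smul_eq_mul] at a5 a6 ⊢
      simp only [mul_comm (_ : A) (_ : A)] at a1 a2 a3 a4 a5 a6 ⊢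
      linear_combination (norm := (field_simp; ring_nf)) t * a1 - 2 * a2 - 2 * a3 - a4 - a5 - a6
    · have c1 := H.pi_mul_polar h2 hid1 hid2 hs hu hv hz
      have c2 := H.pi_sq_mul h2 hid1 hid2 hu hw
      have c3 := H.half_cube_polar₃ h2 hid1 hu hv huz
      have c4 := H.half_mul_mul h2 hid1 hid2 hv hp hz
      have c5 := congrArg (v * ·) (H.two_smul_pi_mul_half h2 hid1 hu hz)
      have c6 := congrArg (u * ·) (H.two_smul_pi_mul_half h2 hid1 hu hw)
      have c7 := H.half_cube_polar h2 hid1 hu huw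
      have c8 := H.half_mul_mul h2 hid1 hid2 hu hw hzz
      have c9 := congrArg (w * ·) (H.half_mul_sq h2 hid1 hid2 hu hz)
      have d1 := H.half_mul_mul h2 hid1 hid2 huz hz hw
      have d2 := congrArg (z * ·) (H.half_mul_sq h2 hid1 hid2 hv hz)
      have d3 := H.half_mul_sq h2 hid1 hid2 hvz hz
      have d4 := H.half_mul_sq h2 hid1 hid2 hu hz
      have d6 := H.half_mul_mul h2 hid1 hid2 hu hz hw
      have d7 := H.half_cube h2 hid1 hu
      simp only [mul_smul_comm] at c5 c6 c9 d2
      simp only [mul_add, add_mul, mul_smul_comm, smul_mul_assoc, map_add, map_smul, smul_add,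
        add_smul, smul_smul, smul_eq_mul]
      simp only [mul_comm (_ : A) (_ : A)] at c1 c2 c3 c4 c5 c6 c7 c8 c9 d1 d2 d3 d4 d6 d7 ⊢
      linear_combination (norm := (match_scalars <;> field_simp <;> ring_nf))
        ((2⁻¹ : F) * s) • d7 + ((2⁻¹ : F) * s) • d4 + t • d6 + (2 : F) • c1 - (2 : F) • c3 + c4 - c5 + c2
          - c6 - c7 - c8 - c9 + (2 : F) • d1 + d3 - d2
  · have b1 := H.pi_mul_half h2 hid1 hv huz hz
    have b2 := H.pi_mul_half h2 hid1 hu hv hzz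
    have b3 := congrArg (fun x => π (v * x)) (H.half_mul_sq h2 hid1 hid2 hu hz)
    have b4 := H.two_smul_pi_mul_half h2 hid1 hu (H.zero_mul_zero z w hz hw)
    have b5 := congrArg (fun x => π (u * x)) (H.half_mul_mul h2 hid1 hid2 hu hz hw)
    have b6 := congrArg (z * ·) (H.two_smul_pi_mul_half h2 hid1 hu hw)
    have b7 := H.pi_mul_half h2 hid1 hu huw hz
    have b8 := H.pi_mul_half h2 hid1 hu hv hp
    have b9 := congrArg (fun x => π (v * x)) (H.half_cube h2 hid1 hu)
    have g1 := hZ z w hz hw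
    have g2 := H.pi_mul_half h2 hid1 hu hv hz
    simp only [mul_add, add_mul, mul_smul_comm, smul_mul_assoc, map_add, map_smul, smul_add,
      add_smul, smul_smul] at b3 b5 b6 b9 ⊢
    simp only [mul_comm (_ : A) (_ : A)] at b1 b2 b3 b4 b5 b6 b7 b8 b9 g1 g2 ⊢
    linear_combination (norm := (match_scalars <;> field_simp <;> ring_nf))
      -(t • g2) + b8 + b9 + b2 + b3 - (2 : F) • b1 + b4 + (2 : F) • b5 - b6 - (2 : F) • b7 - g1

end PeirceProj

end

theorem stmt19 {F : Type*} [Field F] {A : Type*} [NonUnitalNonAssocCommRing A]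
    [Module F A] [SMulCommClass F A A] [IsScalarTower F A A]
    (h2 : (2 : F) ≠ 0) (hF : 3 < Cardinal.mk F)
    (hid1 : ∀ x : A, (x * x) * (x * x) = ((x * x) * x) * x)
    (hid2 : ∀ x : A, ((x * x) * x) * (x * x) = x * (((x * x) * x) * x))
    (e : A) (he : IsHalfAxis F e)
    (hstar : ∀ u₁ u₂ z : A, e * u₁ = (2⁻¹ : F) • u₁ → e * u₂ = (2⁻¹ : F) • u₂ →
      e * z = 0 →
      ∀ (c₁ c₂ : F) (v₁ v₂ w₁ w₂ : A),
        e * v₁ = (2⁻¹ : F) • v₁ → e * w₁ = 0 → u₁ * (u₂ * z) = c₁ • e + v₁ + w₁ →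
        e * v₂ = (2⁻¹ : F) • v₂ → e * w₂ = 0 → u₂ * (u₁ * z) = c₂ • e + v₂ + w₂ →
        c₁ = c₂) :
    (∀ x y : A, (x * y) * (x * x) = x * (y * (x * x))) ↔
      (∀ z₁ z₂ : A, e * z₁ = 0 → e * z₂ = 0 →
        z₁ * ((z₁ * z₁) * z₂) = (z₁ * z₁) * (z₁ * z₂)) := by
  constructor
  · intro h z w _ _
    rw [mul_comm (z * z) w, ← h z w, mul_comm]
  · intro hZ x y
    obtain ⟨φ, π, H⟩ := he.exists_peirceProj h2
    have hs : ∀ u v z : A, e * u = (2⁻¹ : F) • u → e * v = (2⁻¹ : F) • v → e * z = 0 →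
        φ (u * (v * z)) = φ (v * (u * z)) := by
      intro u v z hu hv hz
      refine hstar u v z hu hv hz _ _ 0 0 (π (u * (v * z))) (π (v * (u * z)))
        (by simp) (H.mul_pi _) ?_ (by simp) (H.mul_pi _) ?_
      · rw [add_zero]
        exact H.half_mul_half _ _ hu (H.half_mul_zero v z hv hz)
      · rw [add_zero]
        exact H.half_mul_half _ _ hv (H.half_mul_zero u z hu hz)
    obtain ⟨t, u, z, hu, hz, rfl⟩ := he.decomp x
    obtain ⟨s, v, w, hv, hw, rfl⟩ := he.decomp y
    exact H.jordan h2 hid1 hid2 hs hZ t s hu hv hz hw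
end
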